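/- Let $C_{12}'\subseteq\mathbb{R}^6$ be the cone generated by $z_1=(0,1,0,0,0,0)$, $z_2=(0,0,1,0,0,0)$, $z_3=(0,0,0,1,0,0)$, $z_4=(0,0,0,0,1,0)$, $z_5=(0,0,0,0,0,1)$, $z_6=(1,0,2,1,1,2)$, $z_7=(1,2,0,2,1,1)$, $z_8=(1,1,2,0,2,1)$, $z_9=(1,1,1,2,0,2)$, $z_{10}=(1,2,1,1,2,0)$, $z_{11}''=(0,-1,2,-1,-1,2)$, $z_{12}''=(1,0,3,0,0,3)$. Then $C_{12}'$ satisfies the integral Carathéodory property: every lattice point $x\in C_{12}'\cap\mathbb{Z}^6$ can be written as $x=a_1y_1+\dots+a_6y_6$ where $a_1,\dots,a_6$ are nonnegative integers and $y_1,\dots,y_6$ are six linearly independent vectors among the twelve generators. -/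

import Mathlib

/-- The real vector corresponding to an integer vector. -/
def toR {d : ℕ} (x : Fin d → ℤ) : Fin d → ℝ := fun i => (x i : ℝ)

/-- The cone generated by a finite family of integer vectors. -/
def coneFin {d n : ℕ} (v : Fin n → (Fin d → ℤ)) : Set (Fin d → ℝ) :=
  { y | ∃ a : Fin n → ℝ, (∀ i, 0 ≤ a i) ∧ y = ∑ i, a i • toR (v i) }

/-- The cone generated by a set of integer vectors (nonnegative real combinations
of finitely many of its elements). -/
def coneSet {d : ℕ} (B : Set (Fin d → ℤ)) : Set (Fin d → ℝ) :=
  { y | ∃ (n : ℕ) (v : Fin n → (Fin d → ℤ)) (a : Fin n → ℝ),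
      (∀ i, v i ∈ B) ∧ (∀ i, 0 ≤ a i) ∧ y = ∑ i, a i • toR (v i) }

/-- A finitely generated rational cone. -/
def IsRatCone {d : ℕ} (C : Set (Fin d → ℝ)) : Prop :=
  ∃ B : Finset (Fin d → ℤ), C = coneSet (B : Set (Fin d → ℤ))

/-- A pointed cone: `x, -x ∈ C` implies `x = 0`. -/
def PointedSet {d : ℕ} (C : Set (Fin d → ℝ)) : Prop :=
  ∀ x ∈ C, -x ∈ C → x = 0

/-- A full-dimensional subset of `ℝ^d`. -/
def FullDim {d : ℕ} (C : Set (Fin d → ℝ)) : Prop :=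
  Submodule.span ℝ C = ⊤

/-- The Hilbert basis of the monoid `C ∩ ℤ^d`: the nonzero lattice points of `C`
admitting no decomposition into two nonzero lattice points of `C`. -/
def hilbC {d : ℕ} (C : Set (Fin d → ℝ)) : Set (Fin d → ℤ) :=
  { z | toR z ∈ C ∧ z ≠ 0 ∧
    ¬∃ u v : Fin d → ℤ, toR u ∈ C ∧ toR v ∈ C ∧ u ≠ 0 ∧ v ≠ 0 ∧ z = u + v }

/-- The twelve generators of the cone `C₁₂'`: the Hilbert basis of `C₁₀`
together with `z₁₁'' = (0,-1,2,-1,-1,2)` and `z₁₂'' = (1,0,3,0,0,3)`. -/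
def w : Fin 12 → (Fin 6 → ℤ) :=
  ![![0, 1, 0, 0, 0, 0],
    ![0, 0, 1, 0, 0, 0],
    ![0, 0, 0, 1, 0, 0],
    ![0, 0, 0, 0, 1, 0],
    ![0, 0, 0, 0, 0, 1],
    ![1, 0, 2, 1, 1, 2],
    ![1, 2, 0, 2, 1, 1],
    ![1, 1, 2, 0, 2, 1],
    ![1, 1, 1, 2, 0, 2],
    ![1, 2, 1, 1, 2, 0],
    ![0, -1, 2, -1, -1, 2],
    ![1, 0, 3, 0, 0, 3]]

namespace IntegralCaratheodory

/-- An integer vector with six coordinates, stored so that the kernel evaluates it quickly. It is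
used both for points of `ℤ⁶` and for linear forms on `ℤ⁶`. -/
structure Vec where
  (a b c d e f : ℤ)
deriving DecidableEq

namespace Vec

/-- The value of the linear form `u` at the point `v`. -/
def dot (u v : Vec) : ℤ :=
  u.a * v.a + u.b * v.b + u.c * v.c + u.d * v.d + u.e * v.e + u.f * v.f

/-- `n • u + v`. -/
def smulAdd (n : ℤ) (u v : Vec) : Vec :=
  ⟨n * u.a + v.a, n * u.b + v.b, n * u.c + v.c, n * u.d + v.d, n * u.e + v.e, n * u.f + v.f⟩

/-- The zero vector. -/
def zero : Vec := ⟨0, 0, 0, 0, 0, 0⟩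

/-- All coordinates are even. -/
def IsEven (u : Vec) : Prop :=
  2 ∣ u.a ∧ 2 ∣ u.b ∧ 2 ∣ u.c ∧ 2 ∣ u.d ∧ 2 ∣ u.e ∧ 2 ∣ u.f

instance : DecidablePred IsEven := fun u => by unfold IsEven; infer_instance

/-- The vector with the given coordinate function. -/
def ofFun (x : Fin 6 → ℤ) : Vec := ⟨x 0, x 1, x 2, x 3, x 4, x 5⟩

/-- The coordinate function of a vector. -/
def toFun (u : Vec) : Fin 6 → ℤ := ![u.a, u.b, u.c, u.d, u.e, u.f]

theorem dot_ofFun (u : Vec) (x : Fin 6 → ℤ) : u.dot (ofFun x) = ∑ i, u.toFun i * x i := by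
  simp [dot, ofFun, toFun, Fin.sum_univ_six]

theorem dot_smulAdd (n : ℤ) (u v x : Vec) : (smulAdd n u v).dot x = n * u.dot x + v.dot x := by
  simp only [dot, smulAdd]; ring

theorem IsEven.two_dvd_dot {u : Vec} (hu : u.IsEven) (x : Vec) : 2 ∣ u.dot x := by
  obtain ⟨ha, hb, hc, hd, he, hf⟩ := hu
  exact dvd_add (dvd_add (dvd_add (dvd_add (dvd_add (ha.mul_right _) (hb.mul_right _))
    (hc.mul_right _)) (hd.mul_right _)) (he.mul_right _)) (hf.mul_right _)

end Vec

/-- The generators `w` as vectors. -/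
def generators : List Vec :=
  [⟨0, 1, 0, 0, 0, 0⟩, ⟨0, 0, 1, 0, 0, 0⟩, ⟨0, 0, 0, 1, 0, 0⟩, ⟨0, 0, 0, 0, 1, 0⟩,
   ⟨0, 0, 0, 0, 0, 1⟩, ⟨1, 0, 2, 1, 1, 2⟩, ⟨1, 2, 0, 2, 1, 1⟩, ⟨1, 1, 2, 0, 2, 1⟩,
   ⟨1, 1, 1, 2, 0, 2⟩, ⟨1, 2, 1, 1, 2, 0⟩, ⟨0, -1, 2, -1, -1, 2⟩, ⟨1, 0, 3, 0, 0, 3⟩]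

/-- The `i`-th generator. -/
def generator (i : Fin 12) : Vec := generators.getD i .zero

theorem generator_eq (i : Fin 12) : generator i = .ofFun (w i) := by
  revert i; decide

/-- The linear forms used in the certificate. The first ones, `facetCount` in number, are
nonnegative on the whole cone. -/
def forms : List Vec :=
  [⟨1, 0, 0, 0, 0, 0⟩, ⟨0, 0, 1, 0, 0, 0⟩, ⟨-2, 1, 1, 0, 0, 0⟩, ⟨-2, 1, 0, 0, 0, 1⟩,
   ⟨-2, 0, 1, 1, 0, 0⟩, ⟨-8, 2, 3, 2, 0, 0⟩, ⟨-2, 0, 0, 0, 1, 1⟩, ⟨-1, 0, 1, 0, 1, 0⟩,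
   ⟨0, 0, 0, 0, 0, 1⟩, ⟨-1, 0, 1, 0, 0, 1⟩, ⟨-8, 3, 2, 0, 0, 2⟩, ⟨-1, 0, 0, 1, 0, 1⟩,
   ⟨-7, 2, 2, 1, 0, 1⟩, ⟨-8, 2, 0, 0, 2, 3⟩, ⟨-7, 2, 1, 0, 1, 2⟩, ⟨-6, 1, 1, 1, 1, 1⟩,
   ⟨-2, 2, 0, 0, 0, 1⟩, ⟨-2, 2, 1, 0, 0, 0⟩, ⟨-1, 0, 0, 2, 0, 1⟩, ⟨-2, 0, 1, 2, 0, 0⟩,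
   ⟨-5, 3, 0, 1, 0, 2⟩, ⟨-3, 1, 1, 1, 0, 0⟩, ⟨-2, 0, 0, 0, 2, 1⟩, ⟨-1, 0, 1, 0, 2, 0⟩,
   ⟨-3, 1, 0, 0, 1, 1⟩, ⟨-5, 3, 2, 0, 1, 0⟩, ⟨-3, 0, 1, 1, 1, 0⟩, ⟨-3, 0, 0, 1, 1, 1⟩,
   ⟨-12, 0, 4, 5, 2, 0⟩, ⟨-15, 3, 5, 4, 1, 0⟩, ⟨-9, 2, 3, 2, 1, 0⟩, ⟨-9, 2, 0, 1, 2, 3⟩,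
   ⟨-9, 0, 2, 3, 2, 1⟩, ⟨-12, 0, 0, 2, 5, 4⟩, ⟨-15, 3, 0, 1, 4, 5⟩, ⟨-9, 0, 1, 2, 3, 2⟩,
   ⟨-6, 0, 2, 3, 1, 0⟩, ⟨-6, 2, 0, 1, 1, 2⟩, ⟨-6, 0, 0, 1, 3, 2⟩, ⟨-6, 2, 2, 1, 1, 0⟩,
   ⟨0, 1, 0, 0, 0, 0⟩, ⟨2, 0, -1, 0, 0, 0⟩, ⟨1, 0, 0, -1, 0, 0⟩, ⟨1, 0, 0, 0, -1, 0⟩,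
   ⟨2, 0, 0, 0, 0, -1⟩, ⟨2, -1, 0, 0, 0, 0⟩, ⟨2, 0, 0, -1, 0, 0⟩, ⟨1, 0, 0, 0, 0, -1⟩,
   ⟨4, -1, 0, 0, 0, -2⟩, ⟨2, 0, 1, 0, 0, -2⟩, ⟨3, 0, 0, -1, 0, -1⟩, ⟨4, 0, -1, -2, 0, 0⟩,
   ⟨1, -1, 0, 0, 0, 0⟩, ⟨0, 0, 0, 1, 0, 0⟩, ⟨2, 0, 0, 0, -1, 0⟩, ⟨1, 0, 0, 1, 0, -1⟩,
   ⟨3, 0, 0, 0, -1, -1⟩, ⟨1, 1, 0, 0, -1, 0⟩, ⟨2, 0, 0, -1, -1, 0⟩, ⟨3, -1, 0, 0, -1, 0⟩,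
   ⟨4, -2, -1, 0, 0, 0⟩, ⟨5, -1, 0, 0, -1, -2⟩, ⟨4, 0, 1, 0, -2, -2⟩, ⟨5, 0, 0, -1, -2, -1⟩,
   ⟨1, 0, -1, -1, 0, 1⟩, ⟨6, -2, -1, 0, 0, -2⟩, ⟨6, 0, -1, -2, -2, 0⟩, ⟨1, -1, -1, 0, 1, 0⟩,
   ⟨1, 0, -1, 0, 0, 0⟩, ⟨0, 0, 0, 0, 1, 0⟩, ⟨1, -1, 0, 0, -1, 0⟩, ⟨1, 0, -1, 0, 1, 0⟩,
   ⟨1, 1, 0, -1, 0, 0⟩, ⟨3, 0, -1, -1, 0, 0⟩, ⟨3, -1, 0, 0, 0, -1⟩, ⟨1, 0, 1, 0, 0, -1⟩,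
   ⟨1, -1, 0, 0, 1, 0⟩, ⟨3, 0, 1, 0, -1, -2⟩, ⟨4, 0, 0, -1, -1, -1⟩, ⟨1, -1, 0, 1, 0, -1⟩,
   ⟨5, 0, -1, -2, -1, 0⟩, ⟨3, 0, -1, 0, 0, -1⟩, ⟨4, 0, 0, 0, -1, -2⟩, ⟨1, 0, 1, 0, -1, -1⟩,
   ⟨4, -1, -1, 0, 0, -1⟩, ⟨5, -1, -2, -1, 0, 0⟩, ⟨6, 0, 0, -1, -2, -2⟩, ⟨4, -2, 0, 1, 0, -2⟩,
   ⟨5, -2, -1, 0, 0, -1⟩, ⟨1, 1, 0, -1, -1, 0⟩, ⟨8, 0, -2, -3, -2, 0⟩, ⟨6, -2, -2, -1, 0, 0⟩,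
   ⟨7, -1, -2, -2, -1, 0⟩, ⟨2, 0, -2, 0, 0, 1⟩, ⟨4, 0, 0, 0, -2, -1⟩, ⟨2, 1, 0, 0, -2, 0⟩,
   ⟨3, 0, -1, 0, -1, 0⟩, ⟨4, -1, -2, 0, 0, 0⟩, ⟨1, 0, 0, -1, 0, 1⟩, ⟨1, 0, 1, 0, -1, 0⟩,
   ⟨3, 0, 0, -1, -1, 0⟩, ⟨6, -1, 0, 0, -2, -2⟩, ⟨5, 0, 1, 0, -3, -2⟩, ⟨5, 0, -2, -3, 0, 1⟩,
   ⟨4, 1, 0, -2, -2, 0⟩, ⟨6, -1, -2, -2, 0, 0⟩, ⟨1, 0, -1, 0, 0, 1⟩, ⟨1, -1, 0, 1, 0, 0⟩,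
   ⟨3, -1, -1, 0, 0, 0⟩, ⟨3, 0, -2, -1, 0, 1⟩, ⟨4, 0, -1, -1, -1, 0⟩, ⟨4, -1, 0, 0, -1, -1⟩,
   ⟨3, -2, 0, 1, 0, -1⟩, ⟨4, -2, 0, 0, 0, -1⟩, ⟨2, -2, 0, 0, 1, 0⟩, ⟨4, 0, 0, -2, -1, 0⟩,
   ⟨3, -1, 0, -1, 0, 0⟩, ⟨6, 0, 0, -2, -2, -1⟩, ⟨4, 0, -2, -2, 0, 1⟩, ⟨6, -2, -2, 0, 0, -1⟩,
   ⟨5, -2, -3, 0, 1, 0⟩, ⟨3, 0, -1, -2, 0, 1⟩, ⟨3, -2, -1, 0, 1, 0⟩, ⟨4, -1, -1, -1, 0, 0⟩,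
   ⟨6, -2, 0, 0, -1, -2⟩, ⟨8, 0, 0, -2, -3, -2⟩, ⟨5, -3, 0, 1, 0, -2⟩, ⟨5, 0, -3, -2, 0, 1⟩,
   ⟨6, 0, -2, -2, -1, 0⟩, ⟨4, -2, -2, 0, 1, 0⟩, ⟨7, -1, 0, -1, -2, -2⟩, ⟨7, 0, -1, -2, -2, -1⟩,
   ⟨0, 0, 1, 0, 0, -1⟩, ⟨0, 0, 0, 1, -1, 0⟩, ⟨3, 0, 0, 0, -2, -1⟩, ⟨2, 0, -1, 0, -2, 0⟩,
   ⟨1, 0, 0, -1, 1, 0⟩, ⟨0, 1, 0, -1, 0, 0⟩, ⟨7, -1, 0, 0, -3, -2⟩, ⟨1, 1, 0, -2, 1, 0⟩,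
   ⟨3, -1, -1, 0, -1, 0⟩, ⟨3, -2, 0, 0, 0, -1⟩, ⟨5, 0, 0, 0, -2, -1⟩, ⟨6, 0, -1, 0, -2, 0⟩,
   ⟨2, 0, 0, 1, -1, 0⟩, ⟨8, 0, 0, -1, -3, -2⟩, ⟨4, 0, -3, -2, 0, 2⟩, ⟨2, -2, 1, 0, 0, -2⟩,
   ⟨11, 0, 0, -2, -4, -3⟩, ⟨3, 0, -2, -2, 0, 1⟩, ⟨1, -3, 0, 2, 1, 0⟩, ⟨10, 0, -3, -4, -2, 0⟩,
   ⟨10, -2, -5, -4, 0, 2⟩, ⟨2, 0, 0, -1, 1, 0⟩, ⟨3, -2, -1, 0, 0, 0⟩, ⟨2, -2, -2, 0, 0, 1⟩,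
   ⟨8, 0, -2, -3, -1, 0⟩, ⟨3, -1, -2, -1, 0, 1⟩, ⟨7, -3, 0, 0, -1, -2⟩, ⟨7, 0, 3, 0, -4, -5⟩,
   ⟨14, 0, 0, -3, -5, -4⟩, ⟨7, 0, -5, -4, 0, 3⟩, ⟨7, -4, -1, 0, 0, -1⟩, ⟨0, 2, 0, -1, -1, 0⟩,
   ⟨14, 0, -4, -5, -3, 0⟩, ⟨7, -3, -2, -1, 0, 0⟩, ⟨0, 0, 2, 1, -1, -2⟩, ⟨7, -1, 2, 0, -3, -4⟩,
   ⟨7, -1, -4, -3, 0, 2⟩, ⟨7, 1, 0, -2, -3, -2⟩, ⟨0, 1, 1, 0, -1, -1⟩, ⟨7, -2, -3, -2, 0, 1⟩,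
   ⟨2, 0, 0, -2, 0, -1⟩, ⟨0, 1, 0, 0, -1, 0⟩, ⟨1, 0, 0, 1, -1, 0⟩, ⟨3, 0, -1, -2, 0, 0⟩,
   ⟨3, -1, 0, -1, 0, -1⟩, ⟨7, 0, 1, 0, -4, -3⟩, ⟨7, 0, 0, -1, -3, -2⟩, ⟨5, -3, 0, 1, 0, -1⟩,
   ⟨7, 0, -3, -4, 0, 1⟩, ⟨1, -2, 0, 1, 1, 0⟩, ⟨7, 0, -2, -3, -1, 0⟩, ⟨5, -3, -1, 0, 1, 0⟩,
   ⟨11, -1, 0, -1, -4, -3⟩, ⟨0, 0, 1, 1, -1, -1⟩, ⟨11, -1, 1, 0, -5, -4⟩,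
   ⟨11, -1, -3, -4, -1, 0⟩, ⟨5, -1, -1, 0, -1, 0⟩, ⟨3, -1, 1, 0, -1, -2⟩, ⟨3, 1, -1, -2, -1, 0⟩,
   ⟨3, 0, 1, 0, -2, -2⟩, ⟨10, 0, 0, -2, -4, -3⟩, ⟨1, -3, 0, 1, 2, 0⟩, ⟨5, -4, -1, 0, 2, 0⟩,
   ⟨3, 1, 0, -1, -2, -1⟩, ⟨1, -2, -1, 0, 2, 1⟩, ⟨7, -2, 1, 0, -2, -3⟩, ⟨0, 1, -1, -1, 0, 1⟩,
   ⟨3, 0, -1, 0, 0, 0⟩, ⟨3, 0, 0, 0, 0, -1⟩, ⟨0, 1, 0, 0, -2, 0⟩, ⟨3, 0, -1, 0, -3, 0⟩,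
   ⟨0, 0, 0, 1, -2, 0⟩, ⟨6, 0, -2, -3, 0, 0⟩, ⟨6, -3, -2, 0, 0, 0⟩, ⟨0, 1, 2, 0, 0, -2⟩,
   ⟨3, 0, -1, -2, 1, 0⟩, ⟨3, 0, -2, 0, 0, 1⟩, ⟨0, 2, 0, 0, -1, 0⟩, ⟨3, -2, 0, -1, 0, -1⟩,
   ⟨0, 1, -1, 0, 0, 1⟩, ⟨9, -4, -2, 0, 0, -1⟩, ⟨15, -2, 0, -1, -4, -5⟩, ⟨9, -2, -4, -3, 0, 1⟩,
   ⟨3, 0, 1, 0, 0, -2⟩, ⟨0, 2, 0, -1, 0, 0⟩, ⟨3, 1, 0, -1, 0, -1⟩, ⟨0, 1, 1, 0, 0, -1⟩,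
   ⟨0, 2, 0, -1, 1, 0⟩, ⟨3, -2, -1, 0, -1, 0⟩, ⟨9, -1, 0, -1, -2, -3⟩, ⟨6, 0, 2, 0, -3, -4⟩,
   ⟨6, -4, 0, 1, 0, -2⟩, ⟨6, 0, -4, -3, 0, 2⟩, ⟨6, -3, -1, 0, 0, -1⟩, ⟨6, -4, -2, 0, 1, 0⟩,
   ⟨12, -2, 0, -1, -3, -4⟩, ⟨6, -1, 1, 0, -2, -3⟩, ⟨6, -1, -3, -2, 0, 1⟩,
   ⟨12, -2, -4, -3, -1, 0⟩, ⟨6, -3, 0, 0, 0, -2⟩, ⟨3, 0, 0, -3, 0, -1⟩, ⟨6, 0, 0, 0, -3, -2⟩,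
   ⟨0, 0, 0, 2, -1, 0⟩, ⟨0, 1, 0, -2, 0, 0⟩, ⟨3, 0, 0, 1, -2, -1⟩, ⟨0, 1, -2, 0, 0, 2⟩,
   ⟨0, 1, 0, 2, -2, 0⟩, ⟨9, 0, 1, 0, -5, -4⟩, ⟨9, 0, 0, -1, -4, -3⟩, ⟨9, 0, -4, -5, 0, 1⟩,
   ⟨0, 3, 0, -2, -2, 0⟩, ⟨9, 0, -3, -4, -1, 0⟩, ⟨0, 0, 2, 0, -1, -2⟩, ⟨9, -5, 0, 1, 0, -3⟩,
   ⟨9, -4, -1, 0, 0, -2⟩, ⟨0, 4, 0, -2, -3, 0⟩, ⟨9, -2, -3, -2, 0, 0⟩, ⟨3, 0, -3, -2, 1, 2⟩,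
   ⟨9, -2, 1, 0, -3, -4⟩, ⟨9, -1, -4, -3, 0, 1⟩, ⟨9, -3, -2, -1, 0, -1⟩, ⟨3, 0, 0, -2, 0, -1⟩,
   ⟨3, 0, -1, 0, -2, 0⟩, ⟨3, -2, -2, 0, 0, 1⟩, ⟨3, -1, 0, 1, -2, -1⟩, ⟨3, 0, 2, 0, -2, -3⟩,
   ⟨3, -3, -1, 0, 1, 0⟩, ⟨3, 2, 0, -2, -2, -1⟩, ⟨3, -3, 0, 1, 0, -1⟩, ⟨3, -2, 1, 0, 0, -2⟩,
   ⟨3, 1, 1, 0, -3, -2⟩, ⟨3, 1, -2, -3, 0, 1⟩, ⟨3, 2, -1, -2, -2, 0⟩]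

/-- The number of leading entries of `forms` that are nonnegative on the cone. -/
def facetCount : ℕ := 40

/-- Half-spaces are encoded by natural numbers: `2 * h` stands for the `h`-th linear form and
`2 * h + 1` for its negative. -/
def halfspace (i : ℕ) : Vec :=
  if i % 2 = 0 then forms.getD (i / 2) .zero else .smulAdd (-1) (forms.getD (i / 2) .zero) .zero

/-- A simplicial cone: six generators, each paired with the half-space of the opposite facet. -/
abbrev Simplex := Fin 6 → Fin 12 × ℕ

namespace Simplex

/-- The value at the `k`-th generator of the form of the opposite facet. -/
def height (B : Simplex) (k : Fin 6) : ℤ := (halfspace (B k).2).dot (generator (B k).1)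

/-- The half-spaces of `B` are indeed those of the facets opposite to its generators. -/
def IsDual (B : Simplex) : Prop :=
  ∀ k, 0 < B.height k ∧ ∀ j, j ≠ k → (halfspace (B k).2).dot (generator (B j).1) = 0

instance : DecidablePred IsDual := fun B => by unfold IsDual; infer_instance

/-- `B` generates `ℤ⁶` as a group. -/
def IsUnimodular (B : Simplex) : Prop := B.IsDual ∧ ∀ k, B.height k = 1

instance : DecidablePred IsUnimodular := fun B => by unfold IsUnimodular; infer_instance

/-- `B` generates the group of all `x` on which the form of its first facet is even. -/
def IsIndexTwo (B : Simplex) : Prop :=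
  B.IsDual ∧ B.height 0 = 2 ∧ ∀ k, B.height k = 1 ∨
    B.height k = 2 ∧ (Vec.smulAdd 1 (halfspace (B k).2) (halfspace (B 0).2)).IsEven

instance : DecidablePred IsIndexTwo := fun B => by unfold IsIndexTwo; infer_instance

end Simplex

/-- The unimodular simplicial cones used in the certificate. -/
def unimodularSimplices : List Simplex :=
  [![(0, 80), (1, 83), (2, 85), (3, 87), (4, 89), (5, 0)],
   ![(0, 97), (1, 98), (2, 101), (3, 87), (5, 95), (6, 88)],
   ![(0, 105), (1, 83), (2, 106), (3, 109), (4, 95), (7, 0)],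
   ![(0, 6), (1, 83), (2, 110), (3, 113), (5, 95), (7, 88)],
   ![(0, 123), (1, 124), (2, 127), (5, 95), (6, 112), (7, 87)],
   ![(0, 105), (1, 137), (2, 93), (3, 138), (4, 89), (8, 0)],
   ![(0, 141), (1, 143), (2, 117), (4, 89), (5, 138), (8, 86)],
   ![(0, 4), (2, 147), (3, 142), (4, 89), (5, 137), (8, 82)],
   ![(0, 149), (1, 150), (2, 93), (3, 12), (6, 88), (8, 95)],
   ![(0, 4), (2, 129), (3, 155), (5, 150), (6, 88), (8, 99)],
   ![(0, 4), (3, 161), (4, 128), (5, 92), (6, 146), (8, 103)],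
   ![(0, 169), (2, 129), (3, 167), (5, 163), (7, 88), (8, 82)],
   ![(2, 129), (3, 123), (5, 176), (6, 168), (7, 4), (8, 131)],
   ![(3, 185), (4, 128), (5, 182), (6, 170), (7, 4), (8, 10)],
   ![(0, 195), (2, 85), (3, 193), (4, 186), (5, 137), (9, 82)],
   ![(0, 91), (1, 18), (2, 197), (3, 12), (6, 16), (9, 94)],
   ![(0, 91), (1, 198), (2, 201), (4, 12), (6, 108), (9, 87)],
   ![(0, 91), (2, 8), (3, 199), (4, 18), (6, 136), (9, 2)],
   ![(0, 203), (1, 204), (2, 127), (5, 12), (6, 188), (9, 87)],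
   ![(0, 208), (1, 161), (4, 127), (5, 200), (6, 85), (9, 87)],
   ![(0, 211), (3, 161), (4, 206), (5, 8), (6, 85), (9, 102)],
   ![(0, 6), (1, 213), (2, 22), (3, 109), (7, 16), (9, 94)],
   ![(0, 6), (2, 219), (3, 167), (5, 212), (7, 187), (9, 82)],
   ![(2, 24), (3, 134), (5, 176), (6, 6), (7, 20), (9, 130)],
   ![(0, 135), (4, 127), (5, 8), (6, 220), (7, 160), (9, 133)],
   ![(2, 171), (3, 240), (4, 239), (5, 137), (8, 194), (9, 4)],
   ![(1, 177), (2, 158), (3, 12), (6, 227), (8, 90), (9, 148)],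
   ![(0, 178), (1, 161), (4, 12), (6, 231), (8, 200), (9, 92)],
   ![(1, 245), (2, 179), (4, 12), (6, 229), (8, 90), (9, 152)],
   ![(2, 247), (3, 244), (4, 177), (6, 136), (8, 90), (9, 4)],
   ![(0, 159), (1, 161), (5, 12), (6, 235), (8, 126), (9, 156)],
   ![(1, 28), (2, 158), (5, 12), (6, 26), (8, 202), (9, 122)],
   ![(0, 159), (3, 161), (5, 242), (6, 236), (8, 207), (9, 129)],
   ![(2, 158), (3, 28), (5, 176), (6, 238), (8, 20), (9, 4)],
   ![(3, 161), (4, 159), (5, 246), (6, 170), (8, 211), (9, 4)],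
   ![(1, 177), (2, 252), (3, 249), (7, 226), (8, 6), (9, 105)],
   ![(0, 261), (1, 166), (5, 251), (7, 234), (8, 126), (9, 117)],
   ![(1, 166), (2, 261), (5, 248), (7, 26), (8, 6), (9, 122)],
   ![(2, 171), (3, 167), (5, 176), (7, 239), (8, 6), (9, 168)],
   ![(0, 178), (4, 263), (6, 256), (7, 160), (8, 8), (9, 181)],
   ![(0, 30), (5, 263), (6, 167), (7, 160), (8, 126), (9, 129)],
   ![(1, 30), (5, 179), (6, 261), (7, 159), (8, 126), (9, 122)],
   ![(2, 30), (5, 176), (6, 167), (7, 28), (8, 135), (9, 122)],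
   ![(3, 30), (5, 176), (6, 170), (7, 159), (8, 24), (9, 129)],
   ![(4, 30), (5, 179), (6, 170), (7, 160), (8, 135), (9, 185)],
   ![(0, 153), (1, 271), (2, 273), (4, 269), (6, 0), (10, 86)],
   ![(0, 278), (1, 103), (4, 157), (5, 272), (6, 266), (10, 86)],
   ![(0, 114), (1, 287), (2, 288), (4, 285), (7, 0), (10, 108)],
   ![(0, 215), (1, 38), (3, 289), (4, 36), (7, 0), (10, 107)],
   ![(1, 121), (2, 214), (3, 115), (4, 283), (7, 0), (10, 104)],
   ![(1, 294), (2, 40), (3, 115), (5, 282), (7, 32), (10, 6)],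
   ![(2, 145), (3, 50), (4, 310), (5, 308), (8, 34), (10, 4)],
   ![(0, 153), (2, 52), (4, 151), (6, 46), (8, 270), (10, 14)],
   ![(0, 185), (4, 157), (5, 52), (6, 312), (8, 103), (10, 160)],
   ![(0, 338), (1, 263), (6, 321), (7, 156), (8, 296), (10, 173)],
   ![(0, 185), (4, 263), (6, 328), (7, 52), (8, 303), (10, 180)],
   ![(0, 185), (5, 263), (6, 333), (7, 156), (8, 124), (10, 128)],
   ![(0, 215), (1, 351), (3, 349), (4, 345), (9, 0), (10, 84)],
   ![(1, 367), (2, 362), (4, 223), (6, 346), (9, 152), (10, 90)],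
   ![(1, 247), (3, 362), (4, 359), (6, 214), (9, 274), (10, 90)],
   ![(0, 369), (1, 370), (5, 357), (6, 188), (9, 156), (10, 126)],
   ![(0, 373), (2, 370), (5, 355), (6, 188), (9, 124), (10, 204)],
   ![(0, 375), (4, 371), (5, 365), (6, 220), (9, 102), (10, 160)],
   ![(0, 223), (1, 213), (2, 54), (7, 189), (9, 284), (10, 108)],
   ![(0, 215), (1, 213), (3, 54), (7, 344), (9, 36), (10, 22)],
   ![(0, 215), (3, 221), (4, 212), (7, 350), (9, 38), (10, 8)],
   ![(1, 378), (2, 261), (5, 222), (7, 189), (9, 114), (10, 6)],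
   ![(0, 261), (1, 263), (7, 385), (8, 54), (9, 320), (10, 250)],
   ![(1, 394), (2, 261), (7, 226), (8, 222), (9, 317), (10, 249)],
   ![(0, 261), (5, 263), (7, 236), (8, 220), (9, 332), (10, 166)],
   ![(1, 263), (6, 261), (7, 391), (8, 222), (9, 338), (10, 178)],
   ![(0, 80), (1, 399), (2, 106), (3, 138), (4, 401), (11, 0)],
   ![(0, 80), (1, 264), (2, 101), (3, 113), (5, 400), (11, 89)],
   ![(0, 80), (1, 193), (2, 266), (4, 113), (5, 138), (11, 86)],
   ![(0, 80), (2, 147), (3, 193), (4, 265), (5, 398), (11, 83)],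
   ![(0, 402), (1, 405), (2, 406), (4, 269), (6, 138), (11, 86)],
   ![(0, 203), (1, 154), (2, 101), (5, 269), (6, 112), (11, 86)],
   ![(0, 211), (3, 414), (4, 101), (5, 409), (6, 146), (11, 102)],
   ![(0, 422), (2, 219), (3, 113), (5, 416), (7, 264), (11, 83)],
   ![(1, 423), (2, 421), (3, 113), (5, 282), (7, 80), (11, 6)],
   ![(3, 58), (4, 428), (5, 182), (6, 42), (7, 210), (11, 10)],
   ![(1, 309), (2, 433), (3, 138), (4, 149), (8, 80), (11, 104)],
   ![(0, 436), (2, 147), (3, 155), (5, 430), (8, 265), (11, 89)],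
   ![(1, 147), (3, 438), (4, 435), (5, 433), (8, 80), (11, 144)],
   ![(2, 147), (3, 441), (4, 437), (5, 308), (8, 80), (11, 4)],
   ![(0, 149), (1, 154), (2, 173), (6, 138), (8, 268), (11, 12)],
   ![(2, 183), (3, 244), (4, 149), (6, 309), (8, 410), (11, 4)],
   ![(1, 154), (2, 443), (5, 148), (6, 48), (8, 202), (11, 123)],
   ![(2, 315), (3, 155), (5, 148), (6, 436), (8, 413), (11, 4)],
   ![(3, 60), (4, 314), (5, 182), (6, 146), (8, 211), (11, 4)],
   ![(1, 451), (2, 446), (3, 249), (7, 148), (8, 283), (11, 104)],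
   ![(2, 183), (3, 452), (4, 451), (7, 309), (8, 216), (11, 104)],
   ![(0, 457), (2, 332), (5, 445), (7, 154), (8, 112), (11, 166)],
   ![(1, 456), (2, 455), (5, 248), (7, 48), (8, 112), (11, 123)],
   ![(0, 459), (3, 333), (5, 449), (7, 146), (8, 218), (11, 128)],
   ![(2, 183), (3, 341), (6, 451), (7, 148), (8, 424), (11, 177)],
   ![(1, 30), (5, 173), (6, 455), (7, 442), (8, 426), (11, 123)],
   ![(3, 30), (5, 182), (6, 458), (7, 315), (8, 429), (11, 128)],
   ![(4, 30), (5, 182), (6, 460), (7, 60), (8, 58), (11, 184)],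
   ![(0, 470), (1, 351), (3, 469), (4, 465), (9, 106), (11, 84)],
   ![(0, 476), (1, 193), (4, 473), (5, 468), (9, 267), (11, 84)],
   ![(0, 211), (3, 193), (4, 218), (5, 351), (9, 146), (11, 84)],
   ![(0, 203), (1, 478), (2, 481), (6, 466), (9, 269), (11, 12)],
   ![(0, 211), (3, 487), (4, 482), (6, 351), (9, 408), (11, 8)],
   ![(1, 217), (2, 224), (3, 249), (7, 462), (9, 283), (11, 6)],
   ![(0, 379), (2, 219), (5, 489), (7, 193), (9, 112), (11, 166)],
   ![(1, 378), (2, 62), (5, 248), (7, 203), (9, 112), (11, 6)],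
   ![(2, 219), (3, 379), (5, 216), (7, 475), (9, 422), (11, 6)],
   ![(0, 380), (4, 64), (6, 256), (7, 486), (9, 56), (11, 8)],
   ![(3, 381), (4, 225), (6, 216), (7, 210), (9, 183), (11, 8)],
   ![(1, 493), (2, 490), (3, 249), (8, 463), (9, 148), (11, 226)],
   ![(1, 500), (2, 68), (5, 248), (8, 202), (9, 48), (11, 26)],
   ![(0, 390), (1, 70), (6, 66), (8, 480), (9, 172), (11, 12)],
   ![(1, 245), (2, 391), (6, 249), (8, 202), (9, 148), (11, 12)],
   ![(2, 397), (3, 249), (7, 492), (8, 216), (9, 451), (11, 177)],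
   ![(1, 30), (5, 248), (7, 68), (8, 62), (9, 454), (11, 260)],
   ![(2, 30), (5, 248), (7, 501), (8, 379), (9, 456), (11, 166)],
   ![(3, 30), (5, 397), (7, 502), (8, 218), (9, 459), (11, 171)],
   ![(3, 30), (6, 396), (7, 504), (8, 224), (9, 183), (11, 177)],
   ![(0, 346), (1, 509), (2, 266), (4, 269), (10, 139), (11, 0)],
   ![(0, 274), (1, 351), (3, 267), (4, 507), (10, 107), (11, 0)],
   ![(1, 309), (2, 275), (3, 347), (4, 283), (10, 81), (11, 0)],
   ![(1, 264), (2, 353), (3, 48), (5, 282), (10, 81), (11, 32)],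
   ![(2, 42), (3, 281), (4, 265), (5, 308), (10, 81), (11, 34)],
   ![(0, 281), (2, 52), (4, 269), (6, 508), (10, 404), (11, 271)],
   ![(1, 281), (2, 275), (4, 269), (6, 346), (10, 402), (11, 152)],
   ![(0, 274), (3, 52), (4, 298), (6, 351), (10, 409), (11, 102)],
   ![(0, 281), (2, 370), (5, 269), (6, 265), (10, 155), (11, 124)],
   ![(0, 281), (4, 371), (5, 52), (6, 266), (10, 415), (11, 102)],
   ![(3, 281), (4, 314), (5, 275), (6, 42), (10, 211), (11, 102)],
   ![(0, 379), (2, 332), (5, 515), (7, 264), (10, 113), (11, 124)],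
   ![(1, 378), (2, 74), (5, 282), (7, 48), (10, 113), (11, 114)],
   ![(1, 42), (3, 74), (5, 282), (7, 352), (10, 420), (11, 40)],
   ![(0, 380), (4, 298), (6, 72), (7, 52), (10, 56), (11, 302)],
   ![(0, 48), (1, 382), (2, 76), (8, 268), (10, 139), (11, 44)],
   ![(2, 315), (3, 48), (5, 308), (8, 265), (10, 437), (11, 311)],
   ![(2, 78), (4, 48), (5, 308), (8, 280), (10, 440), (11, 50)],
   ![(3, 78), (4, 314), (5, 308), (8, 42), (10, 147), (11, 144)],
   ![(0, 340), (2, 52), (6, 383), (8, 268), (10, 155), (11, 150)],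
   ![(2, 52), (4, 341), (6, 309), (8, 280), (10, 245), (11, 152)],
   ![(4, 314), (5, 52), (6, 78), (8, 280), (10, 60), (11, 184)],
   ![(1, 340), (2, 327), (7, 48), (8, 283), (10, 249), (11, 316)],
   ![(2, 397), (3, 341), (7, 309), (8, 283), (10, 451), (11, 324)],
   ![(3, 327), (4, 396), (7, 309), (8, 42), (10, 183), (11, 330)],
   ![(2, 332), (5, 341), (7, 48), (8, 379), (10, 457), (11, 334)],
   ![(3, 333), (5, 397), (7, 315), (8, 42), (10, 459), (11, 336)],
   ![(3, 341), (6, 396), (7, 315), (8, 299), (10, 183), (11, 342)],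
   ![(4, 341), (6, 326), (7, 52), (8, 381), (10, 183), (11, 184)],
   ![(0, 346), (1, 382), (2, 54), (9, 269), (10, 467), (11, 188)],
   ![(0, 353), (1, 351), (3, 54), (9, 506), (10, 464), (11, 345)],
   ![(0, 346), (1, 351), (4, 54), (9, 267), (10, 469), (11, 348)],
   ![(1, 351), (3, 347), (4, 353), (9, 274), (10, 470), (11, 214)],
   ![(1, 378), (2, 353), (5, 347), (9, 48), (10, 203), (11, 188)],
   ![(0, 353), (3, 371), (5, 351), (9, 264), (10, 219), (11, 236)],
   ![(0, 524), (2, 370), (6, 383), (9, 269), (10, 479), (11, 354)],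
   ![(0, 526), (3, 371), (6, 351), (9, 299), (10, 483), (11, 360)],
   ![(0, 380), (4, 371), (6, 351), (9, 52), (10, 487), (11, 364)],
   ![(1, 381), (4, 391), (6, 346), (9, 274), (10, 484), (11, 362)],
   ![(3, 381), (4, 526), (6, 351), (9, 274), (10, 211), (11, 246)],
   ![(0, 379), (2, 54), (7, 383), (9, 514), (10, 488), (11, 212)],
   ![(1, 397), (3, 54), (7, 352), (9, 283), (10, 225), (11, 214)],
   ![(2, 397), (3, 379), (7, 522), (9, 283), (10, 217), (11, 212)],
   ![(0, 380), (4, 54), (7, 350), (9, 72), (10, 257), (11, 220)],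
   ![(3, 381), (4, 396), (7, 350), (9, 42), (10, 217), (11, 214)],
   ![(0, 390), (1, 382), (8, 54), (9, 76), (10, 66), (11, 384)],
   ![(0, 390), (6, 383), (8, 370), (9, 52), (10, 70), (11, 262)],
   ![(1, 397), (7, 391), (8, 54), (9, 326), (10, 249), (11, 260)],
   ![(6, 396), (7, 391), (8, 381), (9, 340), (10, 30), (11, 262)]]

/-- The simplicial cones of index two used in the certificate. -/
def indexTwoSimplices : List Simplex :=
  [![(2, 161), (4, 205), (5, 198), (6, 192), (0, 135), (9, 87)],
   ![(2, 209), (4, 203), (5, 90), (6, 190), (1, 135), (9, 87)],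
   ![(0, 239), (2, 237), (8, 186), (9, 88), (3, 167), (5, 137)],
   ![(0, 177), (2, 255), (8, 212), (9, 162), (3, 167), (7, 137)],
   ![(2, 279), (4, 277), (5, 152), (6, 114), (1, 281), (10, 86)],
   ![(2, 300), (6, 114), (7, 152), (10, 118), (1, 121), (4, 223)],
   ![(0, 305), (3, 125), (6, 292), (7, 102), (5, 299), (10, 128)],
   ![(1, 313), (5, 306), (8, 266), (10, 116), (0, 144), (4, 157)],
   ![(1, 332), (5, 321), (8, 290), (10, 116), (0, 261), (7, 156)],
   ![(0, 343), (3, 263), (6, 322), (7, 150), (8, 299), (10, 128)],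
   ![(2, 381), (6, 376), (7, 366), (10, 135), (4, 223), (9, 121)],
   ![(3, 386), (8, 214), (9, 144), (10, 232), (1, 247), (4, 227)],
   ![(1, 237), (5, 385), (8, 188), (10, 234), (0, 261), (9, 156)],
   ![(0, 395), (2, 263), (8, 212), (9, 318), (7, 383), (10, 166)],
   ![(2, 415), (4, 155), (5, 405), (6, 192), (0, 281), (11, 86)],
   ![(0, 283), (1, 417), (7, 400), (11, 95), (2, 106), (3, 113)],
   ![(0, 309), (4, 431), (8, 398), (11, 137), (2, 147), (3, 138)],
   ![(0, 249), (1, 444), (7, 138), (11, 165), (2, 173), (8, 112)],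
   ![(1, 453), (4, 249), (7, 138), (8, 418), (2, 327), (11, 104)],
   ![(1, 183), (3, 173), (6, 447), (11, 175), (7, 148), (8, 224)],
   ![(1, 219), (3, 473), (5, 465), (9, 100), (0, 353), (11, 84)],
   ![(2, 485), (4, 203), (9, 403), (11, 90), (1, 245), (6, 346)],
   ![(1, 211), (3, 485), (6, 471), (11, 90), (4, 225), (9, 274)],
   ![(5, 479), (6, 192), (9, 154), (11, 204), (0, 203), (2, 370)],
   ![(2, 497), (4, 493), (9, 309), (11, 137), (3, 244), (8, 216)],
   ![(2, 257), (4, 249), (9, 453), (11, 259), (7, 244), (8, 216)],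
   ![(2, 299), (6, 283), (7, 511), (10, 425), (3, 341), (11, 120)],
   ![(1, 527), (3, 391), (6, 353), (11, 358), (9, 274), (10, 225)],
   ![(2, 381), (4, 525), (9, 281), (11, 366), (6, 346), (10, 245)],
   ![(2, 529), (4, 383), (9, 309), (11, 388), (8, 346), (10, 245)]]

/-- The `i`-th unimodular simplicial cone. -/
def unimodularSimplex (i : ℕ) : Simplex := unimodularSimplices.getD i fun _ => (0, 0)

/-- The `i`-th simplicial cone of index two. -/
def indexTwoSimplex (i : ℕ) : Simplex := indexTwoSimplices.getD i fun _ => (0, 0)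

/-- A subdivision of a polyhedral cone, given by half-spaces, into pieces each of which is covered
by simplicial cones.
* `unimodular i`: the cone lies in the `i`-th unimodular simplicial cone.
* `parity i j k`: the cone lies in three simplicial cones of index two, and every lattice point
  lies in the lattice of one of them.
* `split h l r`: cut the cone by the `h`-th linear form.
* `derive m t c s`: `m` times the half-space `t` is the combination `c` of known half-spaces. -/
inductive Subdivision
  | unimodular (i : ℕ)
  | parity (i j k : ℕ)
  | split (h : ℕ) (l r : Subdivision)
  | derive (m t : ℕ) (c : List (ℕ × ℕ)) (s : Subdivision)

/-- The nonnegative combination of half-spaces with the given coefficients. -/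
def combination : List (ℕ × ℕ) → Vec
  | [] => .zero
  | (n, i) :: c => .smulAdd n (halfspace i) (combination c)

namespace Subdivision

/-- Correctness of a subdivision of the cone described by the half-spaces in `K`. -/
def check : Subdivision → List ℕ → Bool
  | unimodular i, K => decide ((unimodularSimplex i).IsUnimodular) &&
      decide (∀ k, (unimodularSimplex i k).2 ∈ K)
  | parity i j k, K =>
      [i, j, k].all (fun i => decide ((indexTwoSimplex i).IsIndexTwo) &&
        decide (∀ k, (indexTwoSimplex i k).2 ∈ K)) &&
      decide (Vec.smulAdd 1 (halfspace (indexTwoSimplex i 0).2)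
        (.smulAdd 1 (halfspace (indexTwoSimplex j 0).2)
          (halfspace (indexTwoSimplex k 0).2))).IsEven
  | split h l r, K => l.check (2 * h :: K) && r.check ((2 * h + 1) :: K)
  | derive m t c s, K => decide (0 < m) && c.all (fun p => decide (p.2 ∈ K)) &&
      decide (Vec.smulAdd m (halfspace t) .zero = combination c) && s.check (t :: K)

end Subdivision

/-- A subdivision of the cone generated by `w`. -/
def subdivision : Subdivision :=
  .split 225 (.split 86 (.split 67 (.derive 1 130 [(1, 8), (1, 172), (2, 134)]
  (.derive 2 176 [(1, 6), (1, 450), (1, 130)] (.unimodular 23))) (.split 83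
  (.derive 1 248 [(1, 30), (1, 450), (1, 172)] (.split 130 (.derive 1 454 [(1, 172), (1, 248)]
  (.unimodular 115)) (.derive 1 122 [(1, 172), (1, 248), (1, 261)] (.unimodular 37))))
  (.derive 1 122 [(2, 30), (1, 450), (2, 172), (1, 167)]
  (.derive 2 176 [(1, 450), (1, 167), (1, 122)] (.unimodular 42))))) (.split 69 (.split 61
  (.split 67 (.derive 1 130 [(1, 122), (1, 134)] (.derive 2 176 [(1, 6), (1, 450), (1, 130)]
  (.unimodular 23))) (.split 83 (.derive 2 248 [(1, 450), (1, 122), (1, 166)] (.split 130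
  (.derive 1 454 [(1, 122), (1, 260)] (.unimodular 115)) (.unimodular 37)))
  (.derive 2 176 [(1, 450), (1, 122), (1, 167)] (.unimodular 42)))) (.split 84
  (.derive 2 176 [(1, 450), (1, 168)] (.split 65 (.derive 1 134 [(1, 123), (1, 130)]
  (.unimodular 23)) (.split 92 (.derive 1 182 [(1, 30), (1, 176), (1, 184)]
  (.derive 1 460 [(1, 30), (1, 168), (2, 184)] (.unimodular 98))) (.split 64
  (.derive 1 170 [(1, 168), (1, 128)] (.derive 1 182 [(1, 176), (1, 128)] (.unimodular 13)))
  (.unimodular 12))))) (.split 157 (.split 73 (.derive 2 182 [(1, 450), (1, 314), (1, 146)]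
  (.split 105 (.derive 1 428 [(1, 314), (1, 210)] (.unimodular 80)) (.unimodular 89)))
  (.derive 2 308 [(1, 450), (1, 314), (1, 147)] (.split 72 (.unimodular 137)
  (.derive 1 310 [(1, 314), (1, 145)] (.unimodular 51))))) (.split 214
  (.derive 2 182 [(1, 42), (1, 450), (1, 428)] (.derive 1 210 [(1, 315), (1, 428)]
  (.unimodular 80))) (.split 218 (.split 229 (.derive 2 128 [(1, 169), (1, 458)]
  (.derive 2 182 [(1, 450), (1, 458)] (.unimodular 97))) (.split 227
  (.derive 1 248 [(1, 173), (1, 454)] (.derive 1 260 [(1, 123), (1, 454)] (.unimodular 115)))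
  (.derive 2 430 [(1, 450), (3, 436)] (.derive 2 449 [(1, 450), (3, 459)] (.split 41 (.split 250
  (.derive 1 202 [(1, 123), (1, 82), (1, 500)] (.derive 2 248 [(1, 48), (1, 450), (1, 500)]
  (.unimodular 111))) (.split 83 (.derive 1 112 [(1, 82), (1, 166)] (.split 228
  (.derive 2 248 [(1, 450), (1, 456)] (.unimodular 93)) (.split 77 (.split 166
  (.derive 2 445 [(1, 450), (3, 457)] (.unimodular 92)) (.derive 1 128 [(1, 166), (1, 333)]
  (.derive 1 146 [(1, 154), (1, 333)] (.derive 1 218 [(1, 82), (1, 128)] (.unimodular 94)))))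
  (.split 73 (.derive 1 128 [(1, 166), (1, 155), (1, 146)] (.derive 1 218 [(1, 82), (1, 128)]
  (.derive 1 333 [(1, 155), (1, 146)] (.unimodular 94)))) (.derive 1 89 [(1, 166), (1, 155)]
  (.derive 1 265 [(1, 82), (1, 89)] (.unimodular 82))))))) (.split 44 (.split 64
  (.derive 1 146 [(1, 88), (1, 128)] (.derive 1 218 [(1, 82), (1, 128)]
  (.derive 1 333 [(1, 167), (1, 128)] (.unimodular 94)))) (.derive 2 163 [(1, 450), (3, 169)]
  (.unimodular 11))) (.split 73 (.derive 1 128 [(1, 89), (1, 146)]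
  (.derive 1 218 [(1, 82), (1, 128)] (.derive 1 333 [(1, 167), (1, 128)] (.unimodular 94))))
  (.derive 1 155 [(1, 167), (1, 89)] (.derive 1 265 [(1, 82), (1, 89)] (.unimodular 82)))))))
  (.split 56 (.split 228 (.derive 2 248 [(1, 450), (1, 456)] (.unimodular 93)) (.split 77
  (.split 166 (.derive 1 166 [(1, 83), (1, 112)] (.derive 2 445 [(1, 450), (3, 457)]
  (.unimodular 92))) (.derive 1 128 [(1, 83), (1, 112), (1, 333)]
  (.derive 1 146 [(1, 154), (1, 333)] (.derive 1 218 [(1, 112), (1, 333)] (.unimodular 94)))))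
  (.split 73 (.derive 1 128 [(1, 83), (1, 112), (1, 155), (1, 146)]
  (.derive 1 218 [(1, 112), (1, 155), (1, 146)] (.derive 1 333 [(1, 155), (1, 146)]
  (.unimodular 94)))) (.derive 1 89 [(1, 83), (1, 112), (1, 155)]
  (.derive 1 265 [(1, 112), (1, 155)] (.unimodular 82)))))) (.split 211 (.split 132 (.split 109
  (.derive 1 128 [(1, 83), (1, 218)] (.derive 1 146 [(1, 264), (1, 218)]
  (.derive 1 333 [(1, 113), (1, 218)] (.unimodular 94)))) (.derive 2 416 [(1, 450), (3, 422)]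
  (.unimodular 78))) (.split 73 (.derive 1 128 [(1, 83), (1, 265), (1, 146)]
  (.derive 1 218 [(1, 265), (1, 146)] (.derive 1 333 [(1, 113), (1, 218)] (.unimodular 94))))
  (.derive 1 89 [(1, 83), (1, 265)] (.derive 1 155 [(1, 113), (1, 265)] (.unimodular 82)))))
  (.derive 2 282 [(1, 450), (1, 423)] (.split 40 (.split 210 (.derive 1 352 [(1, 80), (1, 420)]
  (.unimodular 132)) (.unimodular 79)) (.split 176 (.derive 1 420 [(1, 81), (1, 352)]
  (.unimodular 132)) (.derive 1 264 [(1, 436), (1, 81)] (.unimodular 122))))))))))))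
  (.derive 2 308 [(1, 450), (1, 437)] (.split 155 (.derive 1 145 [(1, 315), (1, 310)]
  (.unimodular 51)) (.split 176 (.derive 1 282 [(1, 42), (1, 308), (1, 352)]
  (.derive 1 420 [(1, 42), (1, 437), (2, 352)] (.unimodular 132))) (.split 132
  (.derive 1 81 [(1, 437), (1, 264)] (.derive 1 282 [(1, 308), (1, 264)] (.unimodular 122)))
  (.unimodular 135)))))))))) (.split 176 (.derive 2 282 [(1, 52), (1, 450), (1, 139), (1, 352)]
  (.derive 1 420 [(1, 54), (1, 139), (2, 352)] (.unimodular 132)))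
  (.derive 1 308 [(1, 48), (1, 450), (1, 139)] (.split 140 (.derive 1 440 [(1, 139), (1, 308)]
  (.unimodular 136)) (.derive 1 81 [(1, 139), (1, 308), (1, 281)] (.split 132
  (.derive 1 282 [(1, 308), (1, 264)] (.unimodular 122)) (.unimodular 123)))))))) (.split 175
  (.derive 1 203 [(1, 30), (1, 54), (1, 350)] (.split 108 (.split 109 (.split 190
  (.derive 1 256 [(1, 216), (1, 380)] (.derive 1 486 [(1, 350), (1, 256)] (.unimodular 108)))
  (.derive 1 159 [(1, 6), (1, 8), (1, 350)] (.derive 1 210 [(1, 350), (1, 216)] (.split 91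
  (.split 64 (.split 214 (.unimodular 80) (.derive 1 315 [(1, 210), (1, 429)]
  (.derive 1 458 [(1, 451), (2, 182)] (.unimodular 97))))
  (.derive 1 170 [(1, 451), (2, 182), (1, 129)] (.derive 1 176 [(1, 182), (1, 129)]
  (.unimodular 43)))) (.split 198 (.split 112 (.split 88 (.derive 1 129 [(1, 183), (1, 176)]
  (.derive 1 170 [(1, 396), (1, 176)] (.unimodular 43))) (.derive 1 504 [(1, 210), (1, 224)]
  (.unimodular 118))) (.unimodular 109)) (.split 85 (.derive 1 129 [(1, 183), (1, 397), (1, 170)]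
  (.derive 1 176 [(1, 397), (1, 170)] (.unimodular 43))) (.derive 1 459 [(1, 183), (1, 397)]
  (.derive 1 502 [(1, 218), (1, 210)] (.unimodular 117))))))))) (.split 189
  (.derive 1 112 [(1, 451), (2, 216), (1, 378)] (.derive 1 248 [(1, 216), (1, 378)]
  (.unimodular 106))) (.derive 1 422 [(1, 451), (2, 216)]
  (.derive 1 475 [(1, 350), (1, 216), (2, 219)] (.unimodular 107))))) (.split 128
  (.derive 1 380 [(1, 217), (1, 256)] (.derive 1 486 [(1, 350), (1, 256)] (.unimodular 108)))
  (.split 141 (.split 210 (.derive 1 352 [(1, 42), (1, 350), (1, 282)] (.unimodular 132))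
  (.split 56 (.derive 1 248 [(1, 282), (1, 112)] (.derive 1 378 [(1, 217), (1, 248)]
  (.unimodular 106))) (.derive 1 80 [(1, 42), (1, 350), (1, 282), (1, 421)]
  (.derive 1 423 [(1, 217), (1, 282)] (.unimodular 79))))) (.split 107 (.split 190
  (.derive 1 220 [(1, 214), (1, 380)] (.unimodular 162)) (.split 198 (.unimodular 163) (.split 112
  (.split 124 (.derive 1 112 [(1, 283), (1, 248)] (.derive 1 378 [(1, 217), (1, 248)]
  (.unimodular 106))) (.derive 1 462 [(1, 350), (1, 397), (1, 224)] (.unimodular 104)))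
  (.derive 1 352 [(1, 350), (1, 397)] (.unimodular 160))))) (.split 106 (.split 110
  (.derive 1 380 [(1, 215), (1, 220)] (.unimodular 162)) (.unimodular 65))
  (.derive 1 344 [(1, 350), (1, 213)] (.unimodular 64)))))))) (.split 105
  (.derive 1 159 [(1, 24), (1, 210)] (.split 91 (.split 64 (.split 214 (.unimodular 80)
  (.derive 1 315 [(1, 210), (1, 429)] (.derive 1 458 [(1, 451), (2, 182)] (.unimodular 97))))
  (.derive 1 170 [(1, 451), (2, 182), (1, 129)] (.derive 1 176 [(1, 182), (1, 129)]
  (.unimodular 43)))) (.split 190 (.derive 1 256 [(1, 351), (1, 210), (1, 380)]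
  (.derive 1 486 [(1, 210), (1, 380)] (.unimodular 108))) (.split 189
  (.derive 1 112 [(1, 451), (2, 351), (2, 210), (1, 378)] (.derive 1 203 [(2, 30), (1, 210)]
  (.derive 1 248 [(1, 351), (1, 210), (1, 378)] (.unimodular 106))))
  (.derive 1 216 [(1, 351), (1, 210)] (.split 109 (.split 112 (.derive 1 502 [(1, 210), (1, 218)]
  (.split 88 (.split 85 (.derive 1 129 [(1, 183), (1, 176)] (.unimodular 43))
  (.derive 1 397 [(1, 176), (1, 171)] (.derive 1 459 [(1, 183), (1, 397)] (.unimodular 117))))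
  (.split 198 (.derive 1 504 [(1, 210), (1, 224)] (.unimodular 118))
  (.derive 1 171 [(1, 177), (1, 397)] (.derive 1 459 [(1, 183), (1, 397)] (.unimodular 117))))))
  (.unimodular 109)) (.derive 1 422 [(1, 451), (2, 216)] (.derive 1 475 [(1, 210), (2, 219)]
  (.unimodular 107))))))))) (.split 130 (.split 243 (.derive 1 256 [(1, 351), (1, 486)]
  (.derive 1 380 [(1, 211), (1, 486)] (.unimodular 108))) (.split 263 (.split 140
  (.derive 2 184 [(1, 44), (1, 260), (1, 526), (2, 280)]
  (.derive 1 314 [(2, 52), (1, 526), (2, 280)] (.unimodular 140))) (.split 190 (.split 185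
  (.derive 1 390 [(1, 380), (1, 370)] (.split 191 (.derive 1 384 [(1, 260), (1, 390)]
  (.unimodular 164)) (.derive 1 262 [(1, 54), (1, 260), (1, 380)] (.unimodular 165))))
  (.derive 1 364 [(1, 54), (1, 260), (1, 526)] (.unimodular 156))) (.split 137
  (.derive 1 246 [(1, 54), (1, 260), (1, 526), (1, 381)] (.unimodular 158))
  (.derive 2 102 [(1, 44), (1, 260), (1, 526)] (.derive 1 314 [(1, 526), (2, 275)]
  (.unimodular 129)))))) (.split 195 (.split 191 (.derive 1 384 [(1, 260), (1, 390)]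
  (.unimodular 164)) (.derive 1 262 [(1, 260), (1, 390), (1, 383)]
  (.derive 2 370 [(1, 527), (1, 390)] (.unimodular 165)))) (.derive 1 114 [(1, 74), (1, 260)]
  (.split 124 (.split 56 (.split 227 (.unimodular 115) (.derive 1 123 [(1, 260), (1, 455)]
  (.derive 1 456 [(1, 451), (2, 248)] (.unimodular 93)))) (.derive 1 282 [(1, 248), (1, 113)]
  (.derive 1 378 [(1, 451), (1, 248), (1, 282)] (.unimodular 131)))) (.split 157 (.split 140
  (.derive 1 184 [(1, 48), (1, 260), (1, 314)] (.unimodular 140))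
  (.derive 1 102 [(1, 48), (1, 260), (1, 314), (1, 281)] (.derive 2 275 [(1, 527), (1, 314)]
  (.unimodular 129)))) (.split 198 (.split 91
  (.derive 1 128 [(1, 30), (1, 260), (1, 249), (1, 182)] (.derive 1 429 [(1, 211), (1, 315)]
  (.derive 1 458 [(1, 396), (1, 182)] (.unimodular 97)))) (.split 170
  (.derive 1 262 [(1, 260), (1, 396)] (.derive 2 381 [(1, 527), (1, 391)] (.unimodular 167)))
  (.derive 2 299 [(1, 527), (1, 315)] (.derive 1 342 [(1, 260), (1, 396), (2, 341)]
  (.unimodular 146))))) (.split 170 (.split 141 (.derive 1 113 [(1, 249), (1, 282)]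
  (.derive 1 378 [(1, 340), (1, 282)] (.unimodular 131))) (.split 163 (.unimodular 166)
  (.derive 1 316 [(1, 260), (1, 327)] (.unimodular 141)))) (.split 166 (.split 189
  (.derive 1 113 [(1, 249), (1, 341), (1, 378)] (.derive 1 282 [(1, 341), (1, 378)]
  (.unimodular 131))) (.derive 1 334 [(1, 260), (1, 332)] (.derive 1 457 [(1, 249), (1, 341)]
  (.unimodular 144)))) (.derive 1 336 [(1, 260), (2, 333)] (.derive 1 459 [(1, 451), (2, 397)]
  (.unimodular 145)))))))))))) (.split 243 (.derive 1 256 [(1, 351), (1, 486)]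
  (.derive 1 380 [(1, 211), (1, 486)] (.unimodular 108))) (.split 131
  (.derive 1 144 [(1, 48), (1, 52), (1, 262)] (.split 91 (.split 73 (.split 157 (.unimodular 89)
  (.derive 1 128 [(2, 30), (1, 262), (1, 182)] (.derive 1 429 [(1, 211), (1, 315)]
  (.derive 1 458 [(1, 451), (2, 182)] (.unimodular 97))))) (.derive 1 308 [(1, 182), (1, 147)]
  (.derive 1 314 [(1, 451), (1, 182), (1, 308)] (.unimodular 137)))) (.split 191
  (.derive 1 384 [(1, 262), (1, 382)] (.derive 1 390 [(1, 261), (1, 384)] (.unimodular 164)))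
  (.derive 1 396 [(1, 261), (1, 262)] (.split 245 (.derive 1 177 [(2, 30), (1, 262)]
  (.derive 2 224 [(1, 351), (1, 396), (1, 490)] (.derive 1 504 [(2, 396), (1, 490)]
  (.unimodular 118)))) (.split 154 (.derive 1 147 [(1, 183), (1, 308)]
  (.derive 1 314 [(1, 396), (1, 308)] (.unimodular 137))) (.split 163 (.split 190 (.split 185
  (.derive 1 390 [(1, 380), (1, 370)] (.unimodular 165)) (.derive 1 364 [(1, 262), (1, 371)]
  (.unimodular 156))) (.split 195 (.derive 1 370 [(1, 381), (1, 390)] (.unimodular 165))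
  (.split 170 (.unimodular 167) (.derive 1 184 [(1, 262), (1, 341)] (.unimodular 147)))))
  (.derive 1 330 [(1, 262), (1, 396), (2, 327)] (.unimodular 143))))))))) (.split 134 (.split 86
  (.split 89 (.split 195 (.derive 1 480 [(1, 268), (1, 172)] (.unimodular 112))
  (.derive 1 222 [(1, 12), (1, 268), (1, 172), (1, 391)] (.derive 1 338 [(1, 172), (1, 178)]
  (.unimodular 70)))) (.derive 1 122 [(1, 172), (1, 179)] (.split 79
  (.derive 1 202 [(1, 12), (1, 268), (1, 122)] (.unimodular 31))
  (.derive 1 126 [(2, 12), (1, 268), (1, 172)] (.unimodular 41))))) (.split 77 (.split 69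
  (.split 61 (.split 79 (.derive 1 202 [(1, 12), (1, 268), (1, 122)] (.unimodular 31))
  (.derive 1 126 [(1, 12), (1, 268), (1, 122), (1, 159)] (.derive 1 179 [(1, 173), (1, 122)]
  (.unimodular 41)))) (.split 74 (.split 221 (.derive 1 426 [(1, 268), (1, 148), (1, 442)]
  (.derive 1 455 [(1, 261), (1, 123)] (.unimodular 96))) (.derive 1 202 [(1, 268), (1, 148)]
  (.unimodular 87))) (.unimodular 85))) (.derive 1 382 [(1, 154), (1, 139)] (.unimodular 134)))
  (.split 191 (.derive 1 139 [(1, 155), (1, 382)] (.unimodular 134)) (.split 170 (.split 75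
  (.unimodular 138) (.derive 1 153 [(1, 340), (1, 151)] (.derive 1 270 [(1, 268), (1, 151)]
  (.unimodular 52)))) (.split 76 (.split 74 (.split 157
  (.derive 1 146 [(1, 451), (2, 148), (1, 314)] (.derive 1 182 [(1, 148), (1, 314)]
  (.unimodular 89))) (.derive 1 413 [(1, 268), (1, 155), (1, 341)]
  (.derive 1 436 [(1, 451), (2, 148)] (.unimodular 88)))) (.derive 1 280 [(1, 268), (1, 341)]
  (.split 154 (.split 73 (.derive 1 182 [(1, 308), (1, 146)] (.derive 1 314 [(1, 149), (1, 182)]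
  (.unimodular 89))) (.split 220 (.unimodular 136) (.derive 1 80 [(1, 280), (1, 441)]
  (.derive 1 437 [(1, 149), (1, 308)] (.unimodular 84))))) (.split 122 (.split 91
  (.derive 1 146 [(1, 309), (1, 182)] (.derive 1 314 [(1, 149), (1, 182)] (.unimodular 89)))
  (.derive 1 410 [(1, 280), (1, 244)] (.unimodular 86))) (.unimodular 139)))))
  (.derive 1 151 [(1, 341), (1, 153)] (.derive 1 270 [(1, 268), (1, 151)] (.unimodular 52))))))))
  (.split 106 (.split 101 (.split 157 (.derive 1 146 [(1, 451), (2, 269), (2, 202), (1, 314)]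
  (.derive 1 182 [(1, 269), (1, 202), (1, 314)] (.unimodular 89))) (.split 195
  (.derive 1 172 [(1, 269), (1, 202), (1, 390)] (.derive 1 480 [(1, 202), (1, 390)]
  (.unimodular 112))) (.derive 1 222 [(1, 12), (1, 202)] (.split 61 (.split 79 (.unimodular 31)
  (.split 89 (.derive 1 338 [(1, 122), (2, 178)] (.unimodular 70))
  (.derive 1 126 [(1, 202), (1, 159)] (.unimodular 41)))) (.derive 1 148 [(1, 269), (1, 202)]
  (.split 77 (.split 221 (.split 86 (.derive 1 178 [(1, 123), (1, 172)]
  (.derive 1 338 [(1, 172), (1, 178)] (.unimodular 70))) (.derive 1 426 [(1, 202), (1, 442)]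
  (.derive 1 455 [(1, 261), (1, 123)] (.unimodular 96)))) (.unimodular 87))
  (.derive 1 413 [(1, 202), (2, 155)] (.derive 1 436 [(1, 451), (2, 148)] (.unimodular 88)))))))))
  (.split 140 (.split 141 (.derive 1 308 [(1, 48), (1, 280), (1, 282)]
  (.derive 1 440 [(1, 451), (1, 280), (1, 282), (1, 308)] (.unimodular 136))) (.split 154
  (.split 220 (.unimodular 136) (.split 73 (.derive 1 182 [(1, 308), (1, 146)]
  (.derive 1 314 [(1, 451), (1, 308), (1, 182)] (.unimodular 89)))
  (.derive 1 80 [(1, 280), (1, 441)] (.derive 1 437 [(1, 451), (2, 308)] (.unimodular 84)))))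
  (.split 76 (.split 122 (.split 74 (.split 157 (.derive 1 146 [(1, 309), (1, 148), (1, 314)]
  (.derive 1 182 [(1, 148), (1, 314)] (.unimodular 89))) (.derive 1 155 [(1, 203), (1, 280)]
  (.derive 1 413 [(1, 280), (1, 155)] (.derive 1 436 [(1, 309), (1, 148)] (.unimodular 88)))))
  (.split 91 (.derive 1 146 [(1, 309), (1, 182)] (.derive 1 314 [(1, 149), (1, 182)]
  (.unimodular 89))) (.derive 1 410 [(1, 280), (1, 244)] (.unimodular 86))))
  (.derive 1 341 [(1, 269), (1, 280)] (.unimodular 139)))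
  (.derive 1 151 [(1, 269), (1, 280), (1, 153)] (.derive 1 270 [(1, 280), (1, 153)]
  (.unimodular 52)))))) (.split 239 (.split 240 (.derive 1 172 [(1, 269), (1, 480)]
  (.derive 1 390 [(1, 203), (1, 480)] (.unimodular 112)))
  (.derive 2 188 [(1, 12), (1, 212), (1, 478)] (.split 173 (.split 233 (.unimodular 102)
  (.derive 1 382 [(1, 478), (1, 467)] (.unimodular 148))) (.derive 1 353 [(1, 261), (1, 188)]
  (.derive 1 378 [(1, 203), (1, 478), (2, 347)] (.unimodular 152)))))) (.split 135
  (.derive 1 151 [(1, 269), (1, 270)] (.derive 1 153 [(1, 281), (1, 270)] (.unimodular 52)))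
  (.split 68 (.split 202 (.derive 1 508 [(1, 14), (1, 136), (1, 404)] (.unimodular 124))
  (.split 92 (.split 91 (.derive 1 460 [(1, 52), (1, 136), (2, 184)] (.unimodular 98)) (.split 190
  (.derive 1 364 [(1, 52), (1, 184), (1, 380)] (.derive 1 371 [(1, 263), (1, 364)]
  (.unimodular 156))) (.derive 1 326 [(1, 4), (1, 136), (1, 184), (1, 183)]
  (.derive 1 341 [(1, 263), (1, 184)] (.unimodular 147))))) (.split 80 (.split 89 (.split 151
  (.derive 1 298 [(1, 263), (1, 302)] (.derive 1 380 [(1, 185), (1, 302)] (.unimodular 133)))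
  (.split 90 (.derive 1 328 [(1, 136), (1, 160), (1, 180)] (.unimodular 55))
  (.derive 1 256 [(1, 136), (1, 160)] (.unimodular 39)))) (.derive 1 135 [(1, 211), (1, 160)]
  (.derive 1 170 [(1, 136), (1, 160), (1, 179)] (.unimodular 44))))
  (.derive 1 231 [(1, 136), (1, 161)] (.split 45 (.split 122 (.split 123 (.split 79
  (.derive 1 176 [(1, 246), (1, 158)] (.derive 1 238 [(1, 136), (1, 176)] (.unimodular 33)))
  (.derive 1 170 [(1, 136), (1, 246)] (.unimodular 34))) (.split 88
  (.derive 1 158 [(1, 247), (1, 176)] (.derive 1 238 [(1, 136), (1, 176)] (.unimodular 33)))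
  (.unimodular 29))) (.derive 1 138 [(1, 14), (1, 136)] (.split 89 (.split 136
  (.derive 2 92 [(1, 90), (1, 178), (1, 272)] (.derive 1 200 [(1, 90), (1, 178)]
  (.unimodular 27))) (.derive 2 86 [(1, 90), (1, 178), (1, 273)]
  (.derive 1 402 [(1, 178), (1, 273)] (.derive 1 406 [(1, 273), (1, 86)] (.unimodular 75)))))
  (.split 201 (.derive 2 86 [(1, 90), (1, 402)] (.derive 1 406 [(1, 179), (1, 402), (1, 86)]
  (.unimodular 75))) (.derive 2 152 [(1, 90), (1, 403)] (.derive 1 229 [(1, 136), (1, 245)]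
  (.unimodular 28))))))) (.split 99 (.split 43 (.split 136 (.derive 1 92 [(1, 86), (1, 272)]
  (.derive 1 178 [(1, 91), (1, 86), (1, 92)] (.derive 1 200 [(1, 86), (1, 92)] (.unimodular 27))))
  (.derive 1 153 [(1, 91), (1, 86)] (.unimodular 45))) (.split 100
  (.derive 1 92 [(1, 87), (1, 200)] (.derive 1 178 [(1, 91), (1, 200)] (.unimodular 27)))
  (.derive 1 108 [(1, 136), (1, 198)] (.unimodular 16)))) (.unimodular 17))))))) (.split 88
  (.split 83 (.derive 1 122 [(1, 451), (2, 176), (1, 166)] (.derive 1 248 [(1, 176), (1, 166)]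
  (.unimodular 37))) (.split 85 (.split 79 (.derive 1 238 [(1, 170), (1, 158)] (.unimodular 33))
  (.split 80 (.split 92 (.derive 1 182 [(1, 30), (1, 176), (1, 184)]
  (.derive 1 460 [(1, 170), (1, 184)] (.unimodular 98))) (.derive 1 135 [(1, 211), (1, 160)]
  (.derive 1 179 [(1, 30), (1, 176)] (.unimodular 44)))) (.derive 1 246 [(1, 137), (1, 170)]
  (.unimodular 34)))) (.split 119 (.derive 1 158 [(1, 171), (1, 238)] (.unimodular 33))
  (.derive 1 168 [(1, 451), (2, 176)] (.unimodular 38))))) (.split 141 (.split 40 (.split 210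
  (.derive 1 352 [(1, 80), (1, 420)] (.unimodular 132)) (.split 56
  (.derive 1 248 [(1, 282), (1, 112)] (.derive 1 378 [(1, 451), (1, 282), (1, 248)]
  (.unimodular 106))) (.derive 1 423 [(1, 451), (2, 282)] (.unimodular 79)))) (.split 132
  (.split 176 (.derive 1 420 [(1, 81), (1, 352)] (.unimodular 132)) (.unimodular 122))
  (.derive 1 308 [(1, 282), (1, 265)] (.unimodular 123)))) (.split 151 (.split 204
  (.derive 1 482 [(1, 263), (1, 302), (1, 408)] (.unimodular 103))
  (.derive 2 102 [(1, 271), (1, 302)] (.split 137 (.derive 1 298 [(1, 263), (1, 302)]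
  (.unimodular 126)) (.derive 1 314 [(1, 263), (1, 302), (1, 275)] (.unimodular 129)))))
  (.derive 1 345 [(1, 351), (1, 212)] (.split 40 (.derive 1 441 [(1, 281), (1, 80)] (.split 197
  (.split 124 (.split 189 (.derive 1 112 [(1, 283), (1, 248)] (.unimodular 106))
  (.derive 1 166 [(1, 177), (1, 248)] (.derive 1 456 [(1, 451), (2, 248)]
  (.derive 1 501 [(1, 203), (1, 379)] (.unimodular 116))))) (.split 154
  (.derive 1 147 [(1, 451), (1, 261), (1, 394), (1, 308)] (.derive 1 437 [(1, 451), (2, 308)]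
  (.unimodular 84))) (.split 170 (.split 158 (.derive 1 327 [(1, 261), (1, 316)]
  (.unimodular 141)) (.split 113 (.derive 2 222 [(1, 212), (1, 394)] (.unimodular 68))
  (.derive 1 188 [(1, 212), (1, 394), (1, 227)] (.derive 2 346 [(1, 227), (1, 188)]
  (.derive 1 382 [(1, 394), (1, 227)] (.derive 1 467 [(1, 479), (1, 382)] (.unimodular 148)))))))
  (.derive 1 324 [(1, 394), (2, 341)] (.derive 1 397 [(1, 261), (1, 394)] (.unimodular 142))))))
  (.split 191 (.derive 1 188 [(1, 212), (1, 382)] (.derive 2 346 [(1, 395), (1, 382), (1, 188)]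
  (.derive 1 467 [(1, 479), (1, 382)] (.unimodular 148)))) (.split 210
  (.derive 1 214 [(1, 345), (1, 80), (1, 420)] (.derive 1 225 [(2, 283), (1, 420)]
  (.derive 1 352 [(1, 80), (1, 420)] (.derive 1 397 [(1, 351), (1, 352)] (.unimodular 160)))))
  (.split 202 (.split 174 (.split 254 (.unimodular 124) (.derive 2 346 [(1, 441), (1, 404)]
  (.split 133 (.derive 1 139 [(1, 404), (1, 509)] (.unimodular 119))
  (.derive 1 469 [(1, 404), (1, 509), (2, 267)] (.unimodular 150)))))
  (.derive 1 84 [(1, 46), (1, 404), (1, 349)] (.derive 2 215 [(1, 441), (1, 404), (2, 349)]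
  (.unimodular 57)))) (.derive 1 239 [(1, 137), (1, 177)] (.split 96
  (.derive 1 114 [(1, 4), (1, 192)] (.derive 2 138 [(1, 405), (1, 192)]
  (.derive 2 249 [(1, 177), (1, 395)] (.split 50 (.derive 2 309 [(1, 42), (1, 451), (1, 100)]
  (.split 171 (.derive 2 341 [(1, 263), (1, 342)] (.split 198 (.split 149
  (.derive 1 408 [(1, 100), (1, 298)] (.derive 1 482 [(1, 298), (1, 408)] (.unimodular 103)))
  (.derive 1 315 [(1, 211), (1, 100)] (.split 91 (.derive 1 128 [(1, 177), (1, 182)]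
  (.derive 1 429 [(1, 211), (1, 315)] (.derive 1 458 [(1, 396), (1, 182)] (.unimodular 97))))
  (.unimodular 146)))) (.derive 1 324 [(1, 342), (2, 397)] (.unimodular 142)))) (.split 241
  (.derive 2 408 [(1, 100), (1, 482)] (.unimodular 103)) (.derive 2 183 [(1, 177), (1, 343)]
  (.split 80 (.split 258 (.derive 1 216 [(1, 192), (1, 309), (1, 516)]
  (.derive 2 397 [(1, 192), (2, 343), (1, 160), (2, 516)]
  (.derive 1 492 [(1, 192), (1, 100), (1, 516), (1, 397)] (.unimodular 114))))
  (.derive 1 135 [(1, 211), (1, 160)] (.derive 2 220 [(1, 192), (1, 160)]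
  (.derive 1 385 [(1, 263), (1, 383)] (.split 66 (.split 64 (.split 62
  (.derive 2 156 [(1, 100), (1, 128), (1, 124)] (.split 166 (.derive 1 166 [(1, 128), (1, 332)]
  (.split 118 (.unimodular 69) (.split 125 (.split 194 (.derive 1 188 [(1, 192), (1, 166)]
  (.derive 1 234 [(1, 12), (1, 250)] (.derive 1 245 [(1, 395), (1, 237), (1, 250)]
  (.derive 1 318 [(1, 100), (1, 220), (2, 237), (1, 250)] (.derive 2 346 [(1, 192), (1, 245)]
  (.derive 2 529 [(1, 263), (1, 237), (1, 388)] (.parity 29 12 13))))))) (.split 160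
  (.unimodular 67) (.derive 1 173 [(1, 263), (1, 128)]
  (.derive 3 296 [(2, 192), (1, 100), (1, 332), (3, 250)]
  (.derive 4 338 [(1, 192), (2, 100), (3, 250), (1, 389)] (.unimodular 54))))))
  (.derive 3 112 [(2, 192), (1, 100), (1, 332)] (.derive 1 154 [(1, 100), (1, 220), (1, 237)]
  (.derive 1 445 [(2, 128), (1, 251)] (.derive 1 457 [(1, 261), (1, 128)] (.unimodular 92))))))))
  (.derive 2 185 [(1, 263), (1, 343)] (.unimodular 56)))) (.derive 1 102 [(1, 100), (1, 128)]
  (.derive 2 371 [(1, 125), (1, 102)] (.split 187 (.split 224 (.derive 2 299 [(1, 100), (1, 483)]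
  (.split 150 (.derive 1 292 [(1, 8), (1, 448)] (.derive 1 305 [(1, 343), (1, 299)] (.split 60
  (.derive 2 341 [(1, 125), (1, 120)] (.split 212 (.derive 2 148 [(1, 100), (1, 183), (1, 424)]
  (.unimodular 95)) (.derive 1 150 [(1, 8), (1, 100)] (.derive 1 322 [(1, 128), (1, 448)]
  (.derive 1 511 [(1, 100), (1, 183)] (.parity 6 26 9))))))
  (.derive 1 118 [(1, 483), (1, 128), (1, 374)] (.derive 1 152 [(1, 303), (1, 374)]
  (.derive 2 223 [(1, 125), (1, 121)] (.derive 1 366 [(1, 102), (1, 300)]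
  (.derive 1 376 [(2, 351), (1, 374)] (.derive 1 381 [(1, 300), (1, 121)]
  (.parity 6 5 10)))))))))) (.derive 3 360 [(1, 263), (1, 125), (3, 374), (1, 301)]
  (.derive 2 526 [(1, 125), (1, 374), (1, 301)] (.unimodular 155)))))
  (.derive 2 146 [(1, 192), (1, 100), (1, 371)] (.derive 1 218 [(1, 192), (1, 371)]
  (.derive 1 333 [(1, 220), (1, 125)] (.derive 2 459 [(1, 183), (1, 449)] (.unimodular 94))))))
  (.split 182 (.derive 1 380 [(1, 375), (2, 364)] (.unimodular 156)) (.unimodular 62))))))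
  (.split 260 (.derive 1 216 [(1, 192), (1, 249), (1, 100), (1, 520)]
  (.derive 1 397 [(1, 309), (1, 520)] (.derive 1 492 [(1, 100), (1, 520), (1, 216)]
  (.unimodular 114)))) (.derive 1 126 [(1, 132), (1, 129)] (.split 83 (.split 249
  (.derive 1 236 [(1, 166), (1, 498)] (.derive 1 332 [(1, 129), (1, 166)] (.unimodular 69)))
  (.split 246 (.derive 2 216 [(1, 192), (1, 249), (1, 492)]
  (.derive 2 397 [(1, 249), (1, 499), (1, 492)] (.unimodular 114)))
  (.derive 1 188 [(1, 192), (1, 166)] (.derive 1 204 [(1, 166), (1, 188)]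
  (.derive 2 370 [(1, 192), (1, 499)] (.split 262 (.split 177 (.unimodular 154)
  (.derive 1 124 [(1, 129), (1, 126)] (.derive 1 373 [(1, 524), (2, 355)] (.unimodular 61))))
  (.split 196 (.derive 1 154 [(1, 100), (1, 370)] (.split 122 (.derive 2 216 [(1, 192), (1, 244)]
  (.derive 1 257 [(1, 263), (1, 166)] (.derive 1 259 [(1, 177), (1, 166)]
  (.derive 1 453 [(1, 493), (1, 154)] (.derive 1 497 [(1, 249), (1, 499)] (.parity 24 25 23))))))
  (.derive 2 346 [(1, 192), (1, 245)] (.derive 1 381 [(2, 370), (1, 525)] (.split 242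
  (.derive 1 274 [(1, 129), (1, 392), (1, 484)] (.derive 1 362 [(1, 370), (1, 392)]
  (.derive 1 391 [(1, 370), (1, 525)] (.unimodular 157)))) (.derive 1 90 [(1, 204), (1, 525)]
  (.derive 1 366 [(1, 160), (1, 485)] (.derive 1 403 [(1, 525), (1, 154)]
  (.parity 21 23 28))))))))) (.derive 1 156 [(1, 160), (1, 129)]
  (.derive 1 357 [(1, 370), (2, 525), (1, 393)] (.derive 1 369 [(1, 525), (1, 393), (1, 357)]
  (.unimodular 60))))))))))) (.unimodular 40))))) (.split 63 (.split 125
  (.derive 1 320 [(1, 220), (1, 133), (2, 250)] (.unimodular 67)) (.split 83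
  (.derive 1 117 [(1, 220), (1, 133)] (.derive 1 234 [(1, 160), (1, 166)] (.unimodular 36)))
  (.derive 1 129 [(1, 133), (1, 126)] (.unimodular 40)))) (.unimodular 24)))))))
  (.derive 2 85 [(1, 192), (1, 161)] (.split 118 (.split 103 (.derive 2 102 [(1, 100), (1, 206)]
  (.unimodular 20)) (.derive 2 129 [(1, 100), (1, 207)] (.derive 2 159 [(1, 239), (1, 236)]
  (.derive 1 242 [(1, 137), (1, 236)] (.unimodular 32))))) (.split 63
  (.derive 2 156 [(1, 100), (1, 126)] (.split 117 (.derive 1 112 [(1, 85), (1, 156)]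
  (.derive 1 166 [(1, 161), (1, 234)] (.derive 1 332 [(1, 237), (1, 156)] (.split 222
  (.derive 1 370 [(1, 161), (1, 126)] (.split 184 (.split 112 (.split 58
  (.derive 2 148 [(1, 100), (1, 224)] (.derive 1 165 [(1, 383), (1, 161), (2, 116)]
  (.derive 1 173 [(1, 383), (1, 161), (1, 116)] (.derive 1 175 [(1, 249), (1, 116)]
  (.derive 1 290 [(1, 48), (1, 368)] (.derive 1 321 [(1, 383), (1, 161), (1, 173)]
  (.derive 1 447 [(2, 395), (1, 444), (1, 116)] (.parity 19 17 8))))))))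
  (.derive 1 251 [(1, 383), (1, 161)] (.unimodular 36)))
  (.derive 2 354 [(1, 161), (1, 370), (2, 368), (1, 225)]
  (.derive 1 524 [(1, 161), (1, 368), (1, 225)] (.unimodular 154))))
  (.derive 1 188 [(1, 192), (1, 166)] (.derive 2 357 [(1, 479), (1, 161)] (.unimodular 60)))))
  (.derive 1 154 [(1, 161), (2, 156)] (.derive 2 457 [(1, 249), (1, 445)] (.unimodular 92)))))))
  (.derive 1 159 [(1, 203), (1, 126)] (.unimodular 30)))) (.derive 2 87 [(1, 100), (1, 127)]
  (.derive 1 108 [(1, 137), (1, 192)] (.derive 1 198 [(1, 137), (1, 108)] (.split 104 (.split 100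
  (.unimodular 19) (.derive 1 91 [(1, 208), (2, 201)] (.unimodular 16))) (.split 246
  (.derive 2 216 [(1, 192), (1, 249), (1, 492)] (.derive 2 397 [(1, 177), (1, 237), (1, 492)]
  (.unimodular 114))) (.split 102 (.derive 2 188 [(1, 192), (1, 204)] (.unimodular 18)) (.split 45
  (.split 183 (.split 122 (.derive 1 88 [(1, 100), (1, 85)] (.derive 2 167 [(1, 192), (1, 205)]
  (.split 81 (.derive 1 186 [(1, 192), (1, 167)] (.derive 2 216 [(1, 192), (1, 244)]
  (.derive 1 255 [(1, 137), (1, 237)] (.derive 1 497 [(1, 177), (1, 237)] (.parity 24 2 3)))))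
  (.derive 1 82 [(1, 192), (1, 87)] (.derive 2 129 [(1, 237), (1, 88)]
  (.derive 2 169 [(1, 177), (1, 163)] (.unimodular 11))))))) (.derive 1 121 [(1, 87), (1, 245)]
  (.derive 1 135 [(1, 90), (1, 245)] (.derive 1 190 [(1, 192), (1, 135)]
  (.derive 2 223 [(1, 205), (1, 245)] (.derive 1 376 [(1, 192), (1, 90)]
  (.derive 1 381 [(1, 161), (1, 90)] (.parity 1 0 10)))))))) (.derive 1 152 [(1, 87), (1, 90)]
  (.derive 2 223 [(1, 205), (1, 90), (1, 367)] (.derive 2 346 [(1, 192), (1, 90), (1, 367)]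
  (.derive 2 362 [(1, 209), (3, 90)] (.unimodular 58)))))) (.derive 2 201 [(1, 209), (1, 91)]
  (.unimodular 16))))))))))))))))) (.split 219 (.split 77 (.split 43
  (.derive 2 112 [(1, 192), (1, 154)] (.unimodular 76)) (.split 48 (.split 113 (.split 52
  (.derive 1 148 [(1, 6), (1, 96), (1, 104)]
  (.derive 1 446 [(1, 101), (1, 96), (1, 226), (1, 104)] (.unimodular 90)))
  (.derive 1 252 [(1, 101), (1, 96), (1, 226)] (.unimodular 35))) (.split 45
  (.derive 2 148 [(1, 96), (1, 90)] (.derive 1 158 [(1, 101), (1, 96)] (.unimodular 26)))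
  (.derive 2 94 [(1, 96), (1, 91)] (.derive 1 197 [(1, 101), (2, 94)] (.unimodular 15)))))
  (.split 47 (.derive 1 91 [(1, 97), (2, 94)] (.derive 1 197 [(1, 101), (2, 94)]
  (.unimodular 15))) (.derive 2 88 [(1, 192), (1, 154), (2, 87)] (.derive 1 98 [(1, 154), (1, 87)]
  (.unimodular 1)))))) (.derive 2 265 [(1, 192), (1, 155)] (.split 62 (.split 185
  (.unimodular 127) (.derive 1 102 [(1, 124), (2, 371)] (.split 207
  (.derive 2 146 [(1, 192), (1, 414)] (.derive 1 409 [(1, 263), (1, 101), (1, 124)]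
  (.unimodular 77))) (.derive 2 266 [(1, 192), (1, 415)] (.unimodular 128))))) (.split 51
  (.split 207 (.split 204 (.derive 1 482 [(1, 101), (2, 408)] (.unimodular 103))
  (.derive 2 146 [(1, 192), (1, 414)] (.unimodular 77))) (.derive 2 266 [(1, 192), (1, 415)]
  (.derive 2 371 [(1, 125), (1, 102)] (.unimodular 128)))) (.derive 2 157 [(1, 125), (1, 103)]
  (.derive 1 185 [(1, 281), (1, 103)] (.split 164 (.derive 2 160 [(1, 52), (1, 137), (1, 328)]
  (.derive 1 312 [(2, 52), (1, 328)] (.unimodular 53))) (.split 71 (.split 80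
  (.derive 2 312 [(1, 142), (3, 160)] (.unimodular 53)) (.split 49 (.split 48
  (.derive 1 171 [(1, 239), (1, 101), (1, 96)] (.derive 1 194 [(2, 265), (1, 96)]
  (.derive 1 240 [(1, 155), (1, 96), (1, 194)] (.unimodular 25))))
  (.derive 1 87 [(1, 155), (1, 98)] (.derive 1 88 [(1, 265), (1, 98)]
  (.derive 1 95 [(1, 137), (1, 265)] (.unimodular 1))))) (.split 44 (.split 64
  (.derive 1 92 [(1, 137), (1, 88), (1, 128)] (.derive 1 146 [(1, 88), (1, 128)]
  (.unimodular 10))) (.derive 1 150 [(1, 137), (1, 88)] (.unimodular 9))) (.split 73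
  (.derive 1 92 [(1, 137), (1, 146)] (.derive 1 128 [(1, 89), (1, 146)] (.unimodular 10)))
  (.derive 2 82 [(1, 192), (1, 142)] (.unimodular 7)))))) (.derive 2 86 [(1, 192), (1, 143)]
  (.derive 2 266 [(1, 192), (1, 103), (1, 86)] (.split 76 (.derive 2 89 [(1, 155), (1, 143)]
  (.split 58 (.split 156 (.derive 2 160 [(1, 116), (1, 312)] (.unimodular 53)) (.split 139
  (.derive 2 272 [(1, 152), (1, 278)] (.unimodular 46)) (.split 193
  (.derive 2 147 [(1, 116), (1, 313)] (.split 215 (.derive 3 436 [(1, 451), (2, 430)]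
  (.unimodular 82)) (.derive 2 144 [(1, 438), (1, 116)] (.split 216 (.split 163
  (.derive 1 214 [(1, 266), (1, 152)] (.derive 1 227 [(1, 157), (1, 326)]
  (.derive 1 232 [(1, 152), (1, 116)] (.derive 2 247 [(1, 313), (1, 326)]
  (.derive 1 277 [(1, 281), (1, 125)] (.derive 1 306 [(1, 152), (1, 144)] (.parity 11 4 7)))))))
  (.derive 2 104 [(1, 116), (1, 327)] (.derive 1 309 [(1, 147), (1, 432)] (.split 226
  (.derive 1 183 [(1, 147), (1, 309)] (.derive 2 216 [(1, 192), (1, 309), (1, 452)]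
  (.unimodular 91))) (.derive 1 398 [(1, 192), (1, 138)] (.derive 1 415 [(1, 4), (1, 279)]
  (.derive 1 418 [(1, 192), (1, 309)] (.parity 16 18 14))))))))
  (.derive 2 435 [(1, 147), (1, 431), (1, 433)] (.unimodular 83))))))
  (.derive 2 275 [(1, 152), (1, 279)] (.derive 1 346 [(1, 152), (1, 387), (1, 275)]
  (.derive 2 402 [(1, 116), (1, 279), (1, 387)] (.unimodular 125)))))))
  (.derive 2 141 [(1, 438), (1, 117)] (.unimodular 6)))) (.split 136
  (.derive 1 278 [(1, 153), (2, 272)] (.unimodular 46)) (.unimodular 45))))))))))))) (.split 154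
  (.derive 1 147 [(1, 441), (1, 439)] (.derive 1 437 [(1, 451), (2, 308)] (.unimodular 84)))
  (.split 74 (.split 246 (.derive 2 216 [(1, 192), (1, 249), (1, 492)]
  (.derive 1 397 [(1, 441), (1, 439), (1, 148)] (.unimodular 114))) (.split 45 (.split 113
  (.derive 2 463 [(1, 192), (1, 249), (1, 493)] (.derive 1 490 [(1, 138), (1, 439), (3, 148)]
  (.unimodular 110))) (.derive 1 158 [(1, 138), (1, 439), (3, 148), (2, 227)] (.unimodular 26)))
  (.derive 1 94 [(1, 148), (1, 91)] (.derive 1 197 [(1, 101), (2, 94)] (.unimodular 15)))))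
  (.split 52 (.derive 1 433 [(1, 138), (1, 439)] (.unimodular 81))
  (.derive 1 93 [(1, 138), (1, 439), (2, 105)] (.split 44 (.split 47
  (.derive 1 91 [(1, 149), (1, 94)] (.derive 1 197 [(1, 93), (1, 94)] (.unimodular 15)))
  (.derive 1 150 [(1, 137), (1, 88)] (.unimodular 8))) (.unimodular 5)))))))))))
  (.derive 2 379 [(1, 212), (1, 395)] (.derive 2 509 [(1, 405), (1, 193)] (.split 256 (.split 41
  (.split 97 (.derive 1 171 [(1, 177), (1, 509), (1, 512)] (.derive 1 240 [(1, 193), (2, 194)]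
  (.unimodular 25))) (.derive 1 219 [(1, 281), (1, 193), (1, 512)] (.split 83 (.split 244
  (.derive 1 514 [(1, 82), (1, 166), (1, 488)] (.unimodular 159))
  (.derive 1 112 [(1, 82), (1, 166)] (.unimodular 105))) (.split 93
  (.derive 1 85 [(1, 219), (1, 186)] (.unimodular 14)) (.unimodular 22)))))
  (.derive 1 266 [(1, 48), (1, 512)] (.split 69 (.split 43 (.split 56
  (.derive 1 101 [(1, 203), (1, 512)] (.derive 1 154 [(1, 193), (2, 112)] (.unimodular 76)))
  (.unimodular 73)) (.derive 1 95 [(1, 212), (1, 83)] (.split 56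
  (.derive 1 123 [(1, 379), (1, 83)] (.derive 1 124 [(1, 83), (2, 112)]
  (.derive 1 127 [(1, 203), (1, 512), (2, 87)] (.unimodular 4)))) (.split 44
  (.derive 1 110 [(1, 266), (1, 87), (1, 88)] (.unimodular 3)) (.derive 1 85 [(1, 266), (1, 87)]
  (.unimodular 0)))))) (.derive 1 346 [(1, 80), (1, 139)] (.unimodular 119))))) (.split 69
  (.split 85 (.derive 1 159 [(1, 239), (1, 170)] (.derive 1 161 [(2, 211), (1, 193), (2, 170)]
  (.derive 1 246 [(1, 137), (1, 170)] (.unimodular 34)))) (.split 53 (.split 41 (.split 83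
  (.split 244 (.derive 1 514 [(1, 82), (1, 166), (1, 488)] (.unimodular 159)) (.split 109
  (.derive 1 84 [(1, 193), (1, 166), (1, 218)] (.derive 1 146 [(1, 82), (1, 84)]
  (.unimodular 101))) (.derive 1 112 [(1, 82), (1, 166)] (.unimodular 105)))) (.split 97
  (.derive 1 240 [(1, 193), (2, 194)] (.unimodular 25)) (.split 93 (.split 42
  (.derive 1 146 [(1, 82), (1, 84)] (.derive 1 218 [(1, 186), (1, 84)] (.unimodular 101)))
  (.unimodular 14)) (.split 109 (.derive 1 84 [(1, 187), (1, 218)]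
  (.derive 1 146 [(1, 82), (1, 84)] (.unimodular 101))) (.unimodular 22))))) (.split 132
  (.split 257 (.split 244 (.unimodular 159) (.derive 1 112 [(1, 514), (1, 489)]
  (.derive 1 166 [(1, 83), (1, 112)] (.derive 2 219 [(1, 263), (1, 83), (1, 514)]
  (.unimodular 105))))) (.split 200 (.split 109 (.derive 1 84 [(1, 83), (1, 264), (1, 218)]
  (.derive 1 146 [(1, 264), (1, 218)] (.unimodular 101))) (.split 56
  (.derive 1 166 [(1, 83), (1, 112)] (.derive 1 489 [(1, 515), (1, 112)] (.unimodular 105)))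
  (.split 208 (.derive 2 422 [(1, 283), (1, 416)] (.unimodular 78)) (.split 261
  (.derive 2 217 [(1, 283), (1, 417)] (.derive 2 397 [(1, 351), (1, 522)] (.unimodular 161)))
  (.derive 2 353 [(1, 351), (1, 523)] (.split 180 (.derive 1 236 [(1, 351), (1, 360)]
  (.derive 2 371 [(1, 263), (1, 360)] (.unimodular 153))) (.derive 1 95 [(1, 212), (1, 83)]
  (.split 50 (.split 159 (.derive 1 124 [(1, 515), (1, 318)] (.derive 2 332 [(1, 263), (1, 318)]
  (.unimodular 130))) (.split 232 (.derive 1 506 [(1, 106), (1, 464)] (.unimodular 149))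
  (.split 42 (.derive 1 267 [(1, 113), (1, 100)] (.derive 1 473 [(1, 113), (1, 267)] (.split 235
  (.split 234 (.derive 1 476 [(1, 470), (2, 468)] (.unimodular 100)) (.unimodular 99)) (.split 259
  (.derive 1 468 [(1, 113), (2, 471), (1, 518)] (.derive 2 476 [(1, 113), (1, 518), (3, 468)]
  (.unimodular 100))) (.split 247 (.derive 3 468 [(4, 471), (1, 494)]
  (.derive 3 476 [(5, 471), (2, 494)] (.unimodular 100))) (.derive 1 90 [(2, 84), (1, 471)]
  (.split 179 (.split 112 (.derive 2 148 [(1, 100), (1, 224)] (.derive 1 173 [(1, 54), (1, 113)]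
  (.derive 1 175 [(1, 83), (1, 523), (1, 84)] (.derive 1 183 [(1, 283), (1, 219)]
  (.derive 1 447 [(1, 417), (2, 523), (1, 100)] (.parity 19 15 20))))))
  (.derive 2 274 [(1, 100), (1, 225)] (.derive 1 391 [(1, 473), (1, 471)]
  (.derive 3 485 [(1, 471), (2, 495)] (.derive 1 527 [(1, 219), (1, 471)] (.parity 22 20 27))))))
  (.derive 1 214 [(1, 84), (1, 471)] (.derive 3 247 [(1, 361), (1, 359)]
  (.derive 2 274 [(1, 100), (1, 90), (1, 359)] (.derive 3 362 [(1, 495), (1, 90), (1, 214)]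
  (.unimodular 59)))))))))))) (.derive 1 88 [(1, 100), (1, 85)] (.derive 1 110 [(1, 85), (1, 88)]
  (.unimodular 3)))))) (.split 44 (.derive 1 110 [(1, 101), (2, 88)] (.unimodular 3))
  (.unimodular 72)))))))))) (.derive 1 399 [(1, 264), (1, 401)] (.unimodular 71)))) (.split 199
  (.split 73 (.derive 1 84 [(1, 83), (1, 146)] (.derive 1 218 [(1, 265), (1, 146)]
  (.unimodular 101))) (.unimodular 74)) (.derive 1 401 [(1, 265), (1, 399)] (.unimodular 71)))))
  (.split 176 (.derive 1 214 [(1, 345), (1, 352)] (.derive 1 225 [(1, 283), (1, 107)]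
  (.derive 1 397 [(1, 351), (1, 352)] (.unimodular 160)))) (.split 253
  (.derive 1 464 [(1, 107), (1, 506)] (.unimodular 149)) (.derive 1 267 [(1, 138), (1, 107)]
  (.derive 1 274 [(1, 80), (1, 107)] (.unimodular 120))))))) (.split 174
  (.derive 1 346 [(1, 80), (1, 139)] (.split 133 (.unimodular 119)
  (.derive 1 469 [(1, 139), (2, 267)] (.unimodular 150))))
  (.derive 1 84 [(2, 0), (1, 139), (1, 349)] (.derive 1 215 [(1, 80), (1, 139), (1, 349)]
  (.unimodular 57))))))))))))))) (.split 154 (.derive 1 265 [(1, 283), (1, 308)]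
  (.unimodular 123)) (.split 176 (.derive 1 214 [(1, 345), (1, 352)]
  (.derive 1 225 [(2, 283), (1, 81), (1, 352)] (.derive 1 397 [(1, 351), (1, 352)]
  (.unimodular 160)))) (.split 173 (.split 254 (.derive 1 404 [(1, 81), (1, 346), (1, 508)]
  (.unimodular 124)) (.split 174 (.split 133 (.derive 1 139 [(1, 81), (1, 346)] (.unimodular 119))
  (.derive 1 469 [(1, 81), (1, 346), (2, 267)] (.unimodular 150)))
  (.derive 1 84 [(2, 0), (1, 81), (1, 346), (1, 349)] (.derive 1 215 [(1, 346), (1, 349)]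
  (.unimodular 57))))) (.split 107 (.split 137 (.derive 1 470 [(1, 81), (2, 274)]
  (.unimodular 151)) (.unimodular 121)) (.derive 1 84 [(2, 0), (1, 81), (1, 215)]
  (.derive 1 349 [(1, 347), (1, 215)] (.unimodular 57))))))))))))))))) (.split 101 (.split 124
  (.derive 1 500 [(1, 12), (1, 213), (2, 202)] (.unimodular 111)) (.split 195
  (.derive 1 172 [(1, 269), (1, 202), (1, 390)] (.derive 1 480 [(1, 202), (1, 390)]
  (.unimodular 112))) (.derive 1 148 [(1, 269), (1, 202)]
  (.derive 1 245 [(1, 6), (1, 213), (1, 202), (1, 249)] (.unimodular 113))))) (.split 54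
  (.split 57 (.split 94 (.split 173 (.split 233 (.split 240 (.derive 1 172 [(1, 269), (1, 480)]
  (.derive 1 390 [(1, 203), (1, 480)] (.unimodular 112)))
  (.derive 1 478 [(1, 213), (1, 188), (1, 466)] (.unimodular 102)))
  (.derive 1 382 [(1, 213), (1, 188)] (.unimodular 148))) (.derive 1 353 [(1, 261), (1, 188)]
  (.derive 1 378 [(1, 213), (1, 188), (1, 347)] (.unimodular 152)))) (.split 111
  (.derive 1 378 [(1, 213), (1, 222)] (.unimodular 66)) (.split 142 (.unimodular 63) (.split 144
  (.derive 1 287 [(1, 213), (1, 285)] (.unimodular 47)) (.derive 1 107 [(1, 108), (1, 289)]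
  (.derive 1 215 [(1, 114), (1, 289)] (.unimodular 48))))))) (.split 141
  (.derive 1 294 [(1, 213), (1, 282)] (.unimodular 50)) (.split 107
  (.derive 1 104 [(1, 108), (1, 115)] (.derive 1 121 [(1, 213), (1, 283)] (.unimodular 49)))
  (.derive 1 107 [(1, 108), (1, 115), (1, 215)] (.derive 1 289 [(1, 115), (1, 215)]
  (.unimodular 48)))))) (.split 141 (.derive 1 115 [(1, 6), (1, 109), (1, 282)]
  (.derive 1 294 [(1, 213), (1, 282)] (.unimodular 50))) (.split 47 (.unimodular 21) (.split 52
  (.split 107 (.derive 1 115 [(1, 109), (1, 104)] (.derive 1 121 [(1, 213), (1, 283)]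
  (.unimodular 49))) (.derive 1 107 [(1, 104), (1, 215)] (.derive 1 289 [(1, 109), (1, 107)]
  (.unimodular 48)))) (.split 53 (.derive 1 83 [(1, 213), (1, 95)] (.unimodular 2))
  (.derive 1 215 [(1, 105), (1, 107)] (.derive 1 289 [(1, 109), (1, 107)]
  (.unimodular 48))))))))))))))))

theorem subdivision_check :
    subdivision.check ((List.range facetCount).map (2 * ·)) = true := by
  decide +kernel

theorem halfspace_generator_nonneg :
    ∀ h ∈ List.range facetCount, ∀ i, 0 ≤ (halfspace (2 * h)).dot (generator i) := by
  decide +kernel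

/-- `x` is a nonnegative integral combination of six linearly independent generators. -/
def IsRepresentable (x : Fin 6 → ℤ) : Prop :=
  ∃ y : Fin 6 → (Fin 6 → ℤ),
    (∀ k, ∃ i, y k = w i) ∧
    LinearIndependent ℝ (fun k => toR (y k)) ∧
    ∃ a : Fin 6 → ℕ, x = ∑ k, a k • y k

theorem dot_generator (u : Vec) (i : Fin 12) : u.dot (generator i) = u.toFun ⬝ᵥ w i := by
  rw [generator_eq, Vec.dot_ofFun, dotProduct]

theorem linearIndependent_toR {n : ℕ} {y : Fin n → Fin n → ℤ} (hy : (Matrix.of y).det ≠ 0) :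
    LinearIndependent ℝ (fun k => toR (y k)) := by
  have h : ((Matrix.of y).map (Int.castRingHom ℝ)).det ≠ 0 := by
    rw [← RingHom.mapMatrix_apply, ← RingHom.map_det]
    simpa using hy
  exact Matrix.linearIndependent_rows_of_det_ne_zero h

namespace Simplex

theorem IsDual.isRepresentable {B : Simplex} (hB : B.IsDual) {x : Fin 6 → ℤ}
    (hx : ∀ k, 0 ≤ (halfspace (B k).2).dot (.ofFun x))
    (hdvd : ∀ k, B.height k ∣ (halfspace (B k).2).dot (.ofFun x)) : IsRepresentable x := by
  let y : Matrix (Fin 6) (Fin 6) ℤ := .of fun k => w (B k).1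
  let u : Matrix (Fin 6) (Fin 6) ℤ := .of fun k => (halfspace (B k).2).toFun
  have huy : u * y.transpose = .diagonal B.height := by
    ext k j
    change (halfspace (B k).2).toFun ⬝ᵥ w (B j).1 = _
    rw [← dot_generator]
    rcases eq_or_ne j k with rfl | hjk
    · simp [height]
    · rw [(hB k).2 j hjk, Matrix.diagonal_apply_ne' _ hjk]
  have hdet : u.det * y.det ≠ 0 := by
    rw [← y.det_transpose, ← Matrix.det_mul, huy, Matrix.det_diagonal]
    exact Finset.prod_ne_zero_iff.mpr fun k _ => (hB k).1.ne'
  choose q hq using hdvd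
  have hq0 : ∀ k, 0 ≤ q k := fun k => by
    have := hx k
    rw [hq k] at this
    exact nonneg_of_mul_nonneg_right this (hB k).1
  refine ⟨y, fun k => ⟨_, rfl⟩, linearIndependent_toR (right_ne_zero_of_mul hdet),
    fun k => (q k).toNat, ?_⟩
  have hxy : x = y.transpose.mulVec q := by
    rw [← sub_eq_zero]
    refine Matrix.eq_zero_of_mulVec_eq_zero (left_ne_zero_of_mul hdet) ?_
    rw [Matrix.mulVec_sub, Matrix.mulVec_mulVec, huy, sub_eq_zero]
    ext k
    rw [Matrix.mulVec_diagonal, ← hq k, Vec.dot_ofFun]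
    rfl
  rw [hxy, Matrix.mulVec_eq_sum]
  refine Finset.sum_congr rfl fun k _ => ?_
  rw [← natCast_zsmul, Int.toNat_of_nonneg (hq0 k)]
  ext i
  simp [mul_comm]

theorem IsUnimodular.isRepresentable {B : Simplex} (hB : B.IsUnimodular) {x : Fin 6 → ℤ}
    (hx : ∀ k, 0 ≤ (halfspace (B k).2).dot (.ofFun x)) : IsRepresentable x :=
  hB.1.isRepresentable hx fun k => by simp [hB.2 k]

theorem IsIndexTwo.isRepresentable {B : Simplex} (hB : B.IsIndexTwo) {x : Fin 6 → ℤ}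
    (hx : ∀ k, 0 ≤ (halfspace (B k).2).dot (.ofFun x))
    (h2 : 2 ∣ (halfspace (B 0).2).dot (.ofFun x)) : IsRepresentable x := by
  refine hB.1.isRepresentable hx fun k => ?_
  rcases hB.2.2 k with h | ⟨h, he⟩
  · simp [h]
  · have := he.two_dvd_dot (.ofFun x)
    rw [Vec.dot_smulAdd] at this
    rw [h]
    omega

end Simplex

theorem combination_dot_nonneg {c : List (ℕ × ℕ)} {x : Vec}
    (hc : ∀ p ∈ c, 0 ≤ (halfspace p.2).dot x) : 0 ≤ (combination c).dot x := by
  induction c with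
  | nil => simp [combination, Vec.zero, Vec.dot]
  | cons p c ih =>
    rw [combination, Vec.dot_smulAdd]
    have := hc p (by simp)
    have := ih fun q hq => hc q (by simp [hq])
    positivity

theorem halfspace_odd_dot (h : ℕ) (x : Vec) :
    (halfspace (2 * h + 1)).dot x = -(halfspace (2 * h)).dot x := by
  have h1 : (2 * h + 1) % 2 ≠ 0 := by omega
  have h2 : (2 * h + 1) / 2 = h := by omega
  have h3 : (2 * h) % 2 = 0 := by omega
  have h4 : (2 * h) / 2 = h := by omega
  rw [halfspace, halfspace, if_neg h1, if_pos h3, h2, h4, Vec.dot_smulAdd]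
  simp [Vec.zero, Vec.dot]

theorem Subdivision.isRepresentable {s : Subdivision} {K : List ℕ} (hs : s.check K = true)
    {x : Fin 6 → ℤ} (hx : ∀ i ∈ K, 0 ≤ (halfspace i).dot (.ofFun x)) : IsRepresentable x := by
  induction s generalizing K with
  | unimodular i =>
    simp only [check, Bool.and_eq_true, decide_eq_true_eq] at hs
    exact hs.1.isRepresentable fun k => hx _ (hs.2 k)
  | parity i j k =>
    simp only [check, List.all_cons, List.all_nil, Bool.and_true, Bool.and_eq_true,
      decide_eq_true_eq] at hs
    obtain ⟨⟨⟨hi, hiK⟩, ⟨hj, hjK⟩, hk, hkK⟩, he⟩ := hs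
    have h2 := he.two_dvd_dot (.ofFun x)
    rw [Vec.dot_smulAdd, Vec.dot_smulAdd] at h2
    by_cases h2i : 2 ∣ (halfspace (indexTwoSimplex i 0).2).dot (.ofFun x)
    · exact hi.isRepresentable (fun l => hx _ (hiK l)) h2i
    by_cases h2j : 2 ∣ (halfspace (indexTwoSimplex j 0).2).dot (.ofFun x)
    · exact hj.isRepresentable (fun l => hx _ (hjK l)) h2j
    exact hk.isRepresentable (fun l => hx _ (hkK l)) (by omega)
  | split h l r ihl ihr =>
    simp only [check, Bool.and_eq_true] at hs
    rcases le_total 0 ((halfspace (2 * h)).dot (.ofFun x)) with h0 | h0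
    · exact ihl hs.1 (List.forall_mem_cons.mpr ⟨h0, hx⟩)
    · refine ihr hs.2 (List.forall_mem_cons.mpr ⟨?_, hx⟩)
      rw [halfspace_odd_dot]
      omega
  | derive m t c s ih =>
    simp only [check, Bool.and_eq_true, decide_eq_true_eq, List.all_eq_true] at hs
    obtain ⟨⟨⟨hm, hc⟩, heq⟩, hs⟩ := hs
    refine ih hs (List.forall_mem_cons.mpr ⟨?_, hx⟩)
    have h := combination_dot_nonneg fun p hp => hx _ (hc p hp)
    rw [← heq, Vec.dot_smulAdd] at h
    have hz : Vec.zero.dot (.ofFun x) = 0 := by simp [Vec.zero, Vec.dot]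
    rw [hz, add_zero] at h
    exact nonneg_of_mul_nonneg_right h (by exact_mod_cast hm)

theorem dot_nonneg_of_mem_coneFin {u : Vec} (hu : ∀ i, 0 ≤ u.dot (generator i))
    {x : Fin 6 → ℤ} (hx : toR x ∈ coneFin w) : 0 ≤ u.dot (.ofFun x) := by
  obtain ⟨a, ha, hxa⟩ := hx
  have h : ((u.dot (.ofFun x) : ℤ) : ℝ) = ∑ i, a i * (u.dot (generator i) : ℤ) := by
    have hcast (z : Fin 6 → ℤ) : ((u.toFun ⬝ᵥ z : ℤ) : ℝ) = toR u.toFun ⬝ᵥ toR z := by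
      simp [dotProduct, toR]
    rw [Vec.dot_ofFun, ← dotProduct, hcast, hxa, dotProduct_sum]
    simp only [dot_generator, hcast, dotProduct_smul, smul_eq_mul]
  have h0 : (0 : ℝ) ≤ ((u.dot (.ofFun x) : ℤ) : ℝ) := by
    rw [h]
    exact Finset.sum_nonneg fun i _ => mul_nonneg (ha i) (by exact_mod_cast hu i)
  exact_mod_cast h0

end IntegralCaratheodory

/-- `C₁₂'` satisfies (ICP): every lattice point of `C₁₂'` is a nonnegative
integral combination of six linearly independent vectors among the twelve
generators. -/
theorem C12'_satisfies_ICP :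
    ∀ x : Fin 6 → ℤ, toR x ∈ coneFin w →
      ∃ y : Fin 6 → (Fin 6 → ℤ),
        (∀ k, ∃ i, y k = w i) ∧
        LinearIndependent ℝ (fun k => toR (y k)) ∧
        ∃ a : Fin 6 → ℕ, x = ∑ k, a k • y k := by
  intro x hx
  refine IntegralCaratheodory.Subdivision.isRepresentable
    IntegralCaratheodory.subdivision_check fun i hi => ?_
  obtain ⟨h, hh, rfl⟩ := List.mem_map.mp hi
  exact IntegralCaratheodory.dot_nonneg_of_mem_coneFin
    (IntegralCaratheodory.halfspace_generator_nonneg h hh) hx
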